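/- arXiv:1211.5239 — 7 statements merged into one kernel-verified Lean document; each statement's English description precedes it below -/
import Mathlib

section
/- For every ε > 0, lim_{t→∞} sup_{‖z‖ ≥ ε} | f(tz)/(t^{−d}V(t)) − q(z) | = 0; i.e. the convergence of the normalized density to q, assumed pointwise off the origin and uniform on the unit sphere, is in fact uniform on every complement of a ball around the origin. -/
open MeasureTheory Filter Topology

theorem abs_mul_sub_le_of_abs_sub_one_le {a A q Q δ : ℝ} (hq : |q| ≤ Q)
    (ha : |a - 1| ≤ 1) (haQ : |a - 1| * (Q + 1) ≤ δ / 2) (hA : |A - q| ≤ δ / 4) :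
    |a * A - q| ≤ δ := by
  have h1 : a * A - q = a * (A - q) + (a - 1) * q := by ring
  have ha2 : |a| ≤ 2 := by
    rw [abs_le] at ha ⊢
    constructor <;> linarith [ha.1, ha.2]
  calc |a * A - q| ≤ |a| * |A - q| + |a - 1| * |q| := by
        rw [h1, ← abs_mul, ← abs_mul]; exact abs_add_le _ _
    _ ≤ 2 * (δ / 4) + |a - 1| * (Q + 1) := by
        gcongr
        linarith
    _ ≤ δ := by linarith

section SlowVariation

variable {ι : Type*} {W : ℝ → ℝ} {Φ : ℝ → ι → ℝ} {q : ι → ℝ} {Q : ℝ}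

theorem eventually_abs_shift_sub_le (hW : ∀ x, 0 < W x)
    (hWs : ∀ s, Tendsto (fun x => W (x + s) / W x) atTop (𝓝 1))
    (hQ0 : 0 ≤ Q) (hQ : ∀ i, |q i| ≤ Q) {δ : ℝ} (hδ : 0 < δ) {U : Set ℝ}
    (h : ∀ᶠ x in atTop, ∀ u ∈ U, ∀ i, |Φ (x + u) i / W x - q i| ≤ δ / 4) (s : ℝ) :
    ∀ᶠ x in atTop, ∀ u ∈ U, ∀ i, |Φ (x + (s + u)) i / W x - q i| ≤ δ := by
  have h1 := (tendsto_atTop_add_const_right atTop s tendsto_id).eventually h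
  have hη : 0 < min 1 (δ / 2 / (Q + 1)) := by positivity
  have h2 := (Metric.tendsto_nhds.1 (hWs s)) _ hη
  filter_upwards [h1, h2] with x hx1 hx2 u hu i
  rw [Real.dist_eq] at hx2
  have h3 := hx2.le.trans (min_le_left _ _)
  have h4 := hx2.le.trans (min_le_right _ _)
  rw [le_div_iff₀ (by positivity)] at h4
  have h5 := abs_mul_sub_le_of_abs_sub_one_le (hQ i) h3 h4 (hx1 u hu i)
  have h6 : Φ (x + (s + u)) i / W x
      = W (x + s) / W x * (Φ (id x + s + u) i / W (id x + s)) := by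
    have := (hW x).ne'
    have := (hW (x + s)).ne'
    simp only [id, add_assoc]
    field_simp
  rwa [h6]

theorem exists_nhds_eventually_abs_shift_sub_le (hW : ∀ x, 0 < W x)
    (hWs : ∀ s, Tendsto (fun x => W (x + s) / W x) atTop (𝓝 1))
    (hQ0 : 0 ≤ Q) (hQ : ∀ i, |q i| ≤ Q) (hΦ : ∀ i, Continuous fun x => Φ x i)
    (h : ∀ δ > 0, ∀ᶠ x in atTop, ∀ i, |Φ x i / W x - q i| ≤ δ) {δ : ℝ} (hδ : 0 < δ) :
    ∃ u₀, ∃ U ∈ 𝓝 u₀, ∀ᶠ x in atTop, ∀ u ∈ U, ∀ i, |Φ (x + u) i / W x - q i| ≤ δ := by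
  let S : ℕ → Set ℝ := fun N => {u | ∀ x ≥ (N : ℝ), ∀ i, |Φ (x + u) i / W x - q i| ≤ δ}
  have hS : ∀ N, IsClosed (S N) := by
    intro N
    simp only [S, Set.ofPred_forall]
    refine isClosed_iInter fun x => isClosed_iInter fun _ => isClosed_iInter fun i => ?_
    refine isClosed_le ?_ continuous_const
    have := (hΦ i).comp (continuous_const_add x)
    exact ((this.div_const _).sub continuous_const).abs
  have hU : ⋃ N, S N = Set.univ := by
    refine Set.eq_univ_of_forall fun u => ?_
    have h0 : ∀ᶠ x in atTop, ∀ v ∈ ({0} : Set ℝ), ∀ i, |Φ (x + v) i / W x - q i| ≤ δ / 4 := by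
      simpa using h (δ / 4) (by positivity)
    obtain ⟨M, hM⟩ := eventually_atTop.1 (eventually_abs_shift_sub_le hW hWs hQ0 hQ hδ h0 u)
    obtain ⟨N, hN⟩ := exists_nat_ge M
    refine Set.mem_iUnion.2 ⟨N, fun x hx i => ?_⟩
    simpa using hM x (hN.trans hx) 0 rfl i
  obtain ⟨N, u₀, hu₀⟩ := nonempty_interior_of_iUnion_of_closed hS hU
  refine ⟨u₀, S N, mem_interior_iff_mem_nhds.1 hu₀, ?_⟩
  filter_upwards [eventually_ge_atTop (N : ℝ)] with x hx u hu i using hu x hx i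

/-- A uniform convergence theorem of Karamata type. No measurability of `W` is required, since
the Baire category argument uses the continuity of `Φ`. -/
theorem eventually_forall_isCompact_abs_shift_sub_le (hW : ∀ x, 0 < W x)
    (hWs : ∀ s, Tendsto (fun x => W (x + s) / W x) atTop (𝓝 1))
    (hQ0 : 0 ≤ Q) (hQ : ∀ i, |q i| ≤ Q) (hΦ : ∀ i, Continuous fun x => Φ x i)
    (h : ∀ δ > 0, ∀ᶠ x in atTop, ∀ i, |Φ x i / W x - q i| ≤ δ) {δ : ℝ} (hδ : 0 < δ)
    {K : Set ℝ} (hK : IsCompact K) :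
    ∀ᶠ x in atTop, ∀ u ∈ K, ∀ i, |Φ (x + u) i / W x - q i| ≤ δ := by
  obtain ⟨u₀, U, hU, hx⟩ := exists_nhds_eventually_abs_shift_sub_le hW hWs hQ0 hQ hΦ h
    (δ := δ / 4) (by positivity)
  refine hK.induction_on (p := fun K => ∀ᶠ x in atTop, ∀ u ∈ K, ∀ i,
    |Φ (x + u) i / W x - q i| ≤ δ) (by simp) ?_ ?_ ?_
  · intro s t hst ht
    filter_upwards [ht] with x hx u hu using hx u (hst hu)
  · intro s t hs ht
    filter_upwards [hs, ht] with x h1 h2 u hu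
    exact hu.elim (h1 u) (h2 u)
  · intro u₁ _
    refine ⟨(fun u => u - (u₁ - u₀)) ⁻¹' U, mem_nhdsWithin_of_mem_nhds ?_, ?_⟩
    · refine (continuous_id.sub continuous_const).continuousAt.preimage_mem_nhds ?_
      simpa using hU
    · filter_upwards [eventually_abs_shift_sub_le hW hWs hQ0 hQ hδ hx (u₁ - u₀)]
        with x hx u hu i
      simpa using hx _ hu i

theorem eventually_le_exp_mul_nat (hW : ∀ x, 0 < W x)
    (hWs : ∀ s, Tendsto (fun x => W (x + s) / W x) atTop (𝓝 1)) {η : ℝ} (hη : 0 < η) :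
    ∀ᶠ x in atTop, ∀ k : ℕ, W (x + k) ≤ Real.exp (η * k) * W x := by
  have h1 : ∀ᶠ x in atTop, W (x + 1) / W x < Real.exp η :=
    (hWs 1).eventually_lt_const (Real.one_lt_exp_iff.2 hη)
  obtain ⟨M, hM⟩ := eventually_atTop.1 h1
  filter_upwards [eventually_ge_atTop M] with x hx k
  induction k with
  | zero => simp
  | succ k ih =>
    have h2 := hM (x + k) (hx.trans (by simp))
    rw [div_lt_iff₀ (hW _)] at h2
    push_cast
    rw [← add_assoc, mul_add, mul_one, add_comm (η * k), Real.exp_add, mul_assoc]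
    exact h2.le.trans (by gcongr)

theorem eventually_forall_ge_exp_mul_abs_shift_sub_le (hW : ∀ x, 0 < W x)
    (hWs : ∀ s, Tendsto (fun x => W (x + s) / W x) atTop (𝓝 1))
    (hQ0 : 0 ≤ Q) (hQ : ∀ i, |q i| ≤ Q) (hΦ : ∀ i, Continuous fun x => Φ x i)
    (h : ∀ δ > 0, ∀ᶠ x in atTop, ∀ i, |Φ x i / W x - q i| ≤ δ)
    {β : ℝ} (hβ : 0 < β) (a : ℝ) {δ : ℝ} (hδ : 0 < δ) :
    ∀ᶠ x in atTop, ∀ u ≥ a, ∀ i, Real.exp (-β * u) * |Φ (x + u) i / W x - q i| ≤ δ := by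
  have htail : Tendsto (fun u : ℝ => (2 * Q + 1) * Real.exp (-(β / 2 * u))) atTop (𝓝 0) := by
    have h1 : Tendsto (fun u : ℝ => β / 2 * u) atTop atTop :=
      tendsto_id.const_mul_atTop (by positivity)
    simpa using (Real.tendsto_exp_neg_atTop_nhds_zero.comp h1).const_mul (2 * Q + 1)
  obtain ⟨R, hR⟩ := eventually_atTop.1 (htail.eventually_le_const hδ)
  have hloc := eventually_forall_isCompact_abs_shift_sub_le hW hWs hQ0 hQ hΦ h
    (δ := δ * Real.exp (β * a)) (by positivity) (isCompact_Icc (a := a) (b := max R 0))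
  obtain ⟨M, hM⟩ := eventually_atTop.1 <| eventually_forall_isCompact_abs_shift_sub_le
    hW hWs hQ0 hQ hΦ h one_pos (isCompact_Icc (a := (0 : ℝ)) (b := 1))
  filter_upwards [hloc, eventually_ge_atTop M,
    eventually_le_exp_mul_nat hW hWs (half_pos hβ)] with x hx1 hxM hxk u hu i
  by_cases huR : u ≤ max R 0
  · calc Real.exp (-β * u) * |Φ (x + u) i / W x - q i|
        ≤ Real.exp (-β * a) * (δ * Real.exp (β * a)) := by
          gcongr ?_ * ?_
          · exact Real.exp_le_exp.2 (by nlinarith)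
          · exact hx1 u ⟨hu, huR⟩ i
      _ = δ := by
          rw [mul_left_comm, ← Real.exp_add]; simp
  · push Not at huR
    have hu0 : 0 ≤ u := (le_max_right R 0).trans huR.le
    have hk := Nat.floor_le hu0
    have hk' := Nat.lt_floor_add_one u
    set k := ⌊u⌋₊
    have h1 := hM (x + k) (hxM.trans (by simp)) (u - k) ⟨by linarith, by linarith⟩ i
    rw [show x + k + (u - k) = x + u by ring] at h1
    have h2 : |Φ (x + u) i / W (x + k)| ≤ Q + 1 := by
      have h3 := abs_sub_abs_le_abs_sub (Φ (x + u) i / W (x + k)) (q i)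
      linarith [hQ i]
    have h3 : W (x + k) / W x ≤ Real.exp (β / 2 * u) := by
      rw [div_le_iff₀ (hW x)]
      refine (hxk k).trans ?_
      have := (hW x).le
      gcongr
    have h4 : |Φ (x + u) i / W x| ≤ (Q + 1) * Real.exp (β / 2 * u) := by
      have e : Φ (x + u) i / W x = Φ (x + u) i / W (x + k) * (W (x + k) / W x) := by
        have := (hW (x + k)).ne'
        field_simp
      rw [e, abs_mul, abs_of_pos (div_pos (hW (x + k)) (hW x))]
      exact mul_le_mul h2 h3 (div_pos (hW _) (hW _)).le (by positivity)
    have h5 : 1 ≤ Real.exp (β / 2 * u) := Real.one_le_exp (by positivity)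
    have h6 : |Φ (x + u) i / W x - q i| ≤ (2 * Q + 1) * Real.exp (β / 2 * u) := by
      have := abs_sub (Φ (x + u) i / W x) (q i)
      nlinarith [hQ i]
    calc Real.exp (-β * u) * |Φ (x + u) i / W x - q i|
        ≤ Real.exp (-β * u) * ((2 * Q + 1) * Real.exp (β / 2 * u)) := by gcongr
      _ = (2 * Q + 1) * Real.exp (-(β / 2 * u)) := by
          rw [mul_left_comm, ← Real.exp_add]; ring_nf
      _ ≤ δ := hR u ((le_max_left _ _).trans huR.le)

end SlowVariation

/-- Under condition (a) (pointwise convergence of the normalized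
density to `q` off the origin, uniform on the unit sphere), the convergence
is uniform on every complement of a ball around the origin:
for every `ε > 0`, `lim_{t→∞} sup_{‖z‖ ≥ ε} |f(tz)/(t^{-d} V(t)) - q(z)| = 0`. -/
theorem extreme_risk_uniform_convergence_off_origin
    (d : ℕ) (hd : 2 ≤ d)
    (P : Measure (EuclideanSpace ℝ (Fin d))) [IsProbabilityMeasure P]
    (f : EuclideanSpace ℝ (Fin d) → ℝ)
    (hf_cont : Continuous f) (hf_pos : ∀ z, 0 < f z)
    (hP : P = volume.withDensity (fun z => ENNReal.ofReal (f z)))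
    (α : ℝ) (hα : 0 < α)
    (V : ℝ → ℝ) (hV_pos : ∀ t > (0 : ℝ), 0 < V t)
    (hV_rv : ∀ x > (0 : ℝ),
      Tendsto (fun t => V (t * x) / V t) atTop (𝓝 (x ^ (-α))))
    (q : EuclideanSpace ℝ (Fin d) → ℝ)
    (hq_nonneg : ∀ z : EuclideanSpace ℝ (Fin d), z ≠ 0 → 0 ≤ q z)
    (hq_lim : ∀ z : EuclideanSpace ℝ (Fin d), z ≠ 0 →
      Tendsto (fun t : ℝ => f (t • z) / (t ^ (-(d : ℝ)) * V t)) atTop (𝓝 (q z)))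
    (hq_unif : ∀ δ > (0 : ℝ), ∃ t₀ > (0 : ℝ), ∀ t ≥ t₀,
      ∀ z : EuclideanSpace ℝ (Fin d), ‖z‖ = 1 →
        |f (t • z) / (t ^ (-(d : ℝ)) * V t) - q z| ≤ δ) :
    ∀ ε > (0 : ℝ), ∀ δ > (0 : ℝ), ∃ t₀ > (0 : ℝ), ∀ t ≥ t₀,
      ∀ z : EuclideanSpace ℝ (Fin d), ε ≤ ‖z‖ →
        |f (t • z) / (t ^ (-(d : ℝ)) * V t) - q z| ≤ δ := by
  intro ε hε δ hδ
  let E := EuclideanSpace ℝ (Fin d)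
  let ι := Metric.sphere (0 : E) 1
  let W : ℝ → ℝ := fun x => V (Real.exp x) * Real.exp (α * x)
  let Φ : ℝ → ι → ℝ := fun x θ => f (Real.exp x • (θ : E)) * Real.exp ((d + α) * x)
  have hW : ∀ x, 0 < W x := fun x => mul_pos (hV_pos _ (Real.exp_pos x)) (Real.exp_pos _)
  have hWs : ∀ s, Tendsto (fun x => W (x + s) / W x) atTop (𝓝 1) := by
    intro s
    have h1 := ((hV_rv _ (Real.exp_pos s)).comp Real.tendsto_exp_atTop).mul_const
      (Real.exp (α * s))
    rw [← Real.exp_mul, ← Real.exp_add, show s * -α + α * s = 0 by ring, Real.exp_zero] at h1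
    refine h1.congr fun x => ?_
    simp only [W, Function.comp, mul_add, Real.exp_add]
    have := (hV_pos _ (Real.exp_pos x)).ne'
    field_simp
  have hΦ : ∀ θ, Continuous fun x => Φ x θ := fun θ => by
    simp only [Φ]
    fun_prop
  have key : ∀ x u (θ : E), f (Real.exp x • Real.exp u • θ) /
      (Real.exp x ^ (-(d : ℝ)) * V (Real.exp x)) = Real.exp (-(d + α) * u) *
      (f (Real.exp (x + u) • θ) * Real.exp ((d + α) * (x + u)) / W x) := by
    intro x u θ
    have := (hV_pos _ (Real.exp_pos x)).ne'
    have e : Real.exp ((d + α) * (x + u)) = Real.exp ((d + α) * u) * Real.exp (α * x) *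
        Real.exp (d * x) := by
      rw [← Real.exp_add, ← Real.exp_add]; ring_nf
    simp only [W]
    rw [smul_smul, ← Real.exp_add, ← Real.exp_mul, e, mul_neg, Real.exp_neg, neg_mul,
      Real.exp_neg, mul_comm x]
    field_simp
  have hsph : ∀ θ : ι, ‖(θ : E)‖ = 1 := fun θ => mem_sphere_zero_iff_norm.1 θ.2
  have hunif : ∀ η > 0, ∀ᶠ x in atTop, ∀ θ : ι, |Φ x θ / W x - q θ| ≤ η := by
    intro η hη
    obtain ⟨t₀, -, ht⟩ := hq_unif η hη
    filter_upwards [Real.tendsto_exp_atTop.eventually_ge_atTop t₀] with x hx θ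
    have h1 := ht _ hx θ (hsph θ)
    have h2 := key x 0 θ
    simp only [Real.exp_zero, one_smul, mul_zero, one_mul, add_zero] at h2
    rwa [h2] at h1
  obtain ⟨Q, hQ0, hQ⟩ : ∃ Q, 0 ≤ Q ∧ ∀ θ : ι, |q θ| ≤ Q := by
    obtain ⟨x, hx⟩ := (hunif 1 one_pos).exists
    have hc : Continuous fun θ : ι => Φ x θ / W x := by
      simp only [Φ]
      fun_prop
    obtain ⟨C, hC⟩ := isCompact_univ.exists_bound_of_continuousOn hc.continuousOn
    refine ⟨max (C + 1) 0, le_max_right _ _, fun θ => le_max_of_le_left ?_⟩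
    have h1 := hC θ trivial
    rw [Real.norm_eq_abs] at h1
    have h2 := abs_sub_abs_le_abs_sub (q θ) (Φ x θ / W x)
    rw [abs_sub_comm] at h2
    linarith [hx θ]
  have hqhom : ∀ u (θ : ι), q (Real.exp u • (θ : E)) = Real.exp (-(d + α) * u) * q θ := by
    intro u θ
    have hne : Real.exp u • (θ : E) ≠ 0 :=
      smul_ne_zero (Real.exp_ne_zero u) (norm_ne_zero_iff.1 (by simp [hsph θ]))
    refine tendsto_nhds_unique ((hq_lim _ hne).comp Real.tendsto_exp_atTop) ?_
    have h1 : Tendsto (fun x => Φ (x + u) θ / W x) atTop (𝓝 (q θ)) := by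
      refine Metric.tendsto_nhds.2 fun η hη => ?_
      filter_upwards [eventually_forall_isCompact_abs_shift_sub_le hW hWs hQ0 hQ hΦ hunif
        (half_pos hη) (isCompact_singleton (x := u))] with x hx
      rw [Real.dist_eq]
      linarith [hx u rfl θ]
    exact (h1.const_mul _).congr fun x => (key x u θ).symm
  obtain ⟨M, hM⟩ := eventually_atTop.1 <| eventually_forall_ge_exp_mul_abs_shift_sub_le
    hW hWs hQ0 hQ hΦ hunif (β := d + α) (by positivity) (Real.log ε) hδ
  refine ⟨Real.exp M, Real.exp_pos M, fun t ht z hz => ?_⟩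
  have ht0 : 0 < t := (Real.exp_pos M).trans_le ht
  have hz0 : 0 < ‖z‖ := hε.trans_le hz
  let θ : ι := ⟨‖z‖⁻¹ • z, by
    rw [mem_sphere_zero_iff_norm, norm_smul, norm_inv, norm_norm, inv_mul_cancel₀ hz0.ne']⟩
  have hzθ : z = Real.exp (Real.log ‖z‖) • (θ : E) := by
    rw [Real.exp_log hz0, smul_inv_smul₀ hz0.ne']
  have h1 := hM (Real.log t) ((Real.le_log_iff_exp_le ht0).2 ht) (Real.log ‖z‖)
    (Real.log_le_log hε hz) θ
  have h2 := key (Real.log t) (Real.log ‖z‖) θ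
  rw [← hzθ, Real.exp_log ht0] at h2
  have h3 := hqhom (Real.log ‖z‖) θ
  rw [← hzθ] at h3
  rwa [h2, h3, ← mul_sub, abs_mul, abs_of_pos (Real.exp_pos _)]
end

section
/- For every Borel set B ⊂ ℝ^d that is bounded away from the origin (inf_{z∈B} ‖z‖ > 0), lim_{t→∞} P(X ∈ tB)/V(t) = ∫_B q(z) dz, and this integral is finite. -/
open MeasureTheory Filter Topology Pointwise

/-- A function of exponential decay rate `α` at infinity is bounded, up to a constant, near each
point on a dense subset of a fixed neighbourhood of shifts. No measurability is needed. -/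
lemma exists_shift_bound_on_dense {α : ℝ} {W : ℝ → ℝ} (hW_pos : ∀ u, 0 < W u)
    (hW : ∀ s, Tendsto (fun u => W (u + s) / W u) atTop (𝓝 (Real.exp (-α * s)))) :
    ∃ ε > (0 : ℝ), ∃ C > (0 : ℝ), ∃ u₁ : ℝ, ∃ D : Set ℝ, Metric.ball 0 ε ⊆ closure D ∧
      ∀ s ∈ D, ∀ u ≥ u₁, W (u + s) ≤ C * W u := by
  have bound (s : ℝ) : ∃ N : ℕ, ∀ u ≥ (N : ℝ), W (u + s) ≤ N * W u := by
    have h := (hW s).eventually_lt_const (lt_add_one _)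
    obtain ⟨a, ha⟩ := eventually_atTop.1 h
    obtain ⟨N, hN⟩ := exists_nat_ge (max a (Real.exp (-α * s) + 1))
    refine ⟨N, fun u hu => ?_⟩
    have h1 := ha u (((le_max_left _ _).trans hN).trans hu)
    rw [div_lt_iff₀ (hW_pos u)] at h1
    exact h1.le.trans (mul_le_mul_of_nonneg_right ((le_max_right _ _).trans hN) (hW_pos u).le)
  let A : ℕ → Set ℝ := fun N => {s | ∀ u ≥ (N : ℝ), W (u + s) ≤ N * W u}
  have hcover : ⋃ N, closure (A N) = Set.univ := by
    refine Set.eq_univ_of_forall fun s => ?_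
    obtain ⟨N, hN⟩ := bound s
    exact Set.mem_iUnion.2 ⟨N, subset_closure hN⟩
  obtain ⟨N, c, hc⟩ := nonempty_interior_of_iUnion_of_closed (fun _ => isClosed_closure) hcover
  obtain ⟨ε, hε, hball⟩ := Metric.mem_nhds_iff.1 (mem_interior_iff_mem_nhds.1 hc)
  obtain ⟨M, hM⟩ := bound (-c)
  refine ⟨ε, hε, N * M + 1, by positivity, max M (N + c), (c + ·) ⁻¹' A N, ?_, ?_⟩
  · intro v hv
    have h : c + v ∈ closure (A N) := hball (by simpa using hv)
    exact ((Homeomorph.addLeft c).preimage_closure (A N)).subset h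
  · intro s hs u hu
    have h1 := hM u ((le_max_left _ _).trans hu)
    have h2 := hs (u + -c) (by linarith [le_max_right (M : ℝ) (N + c)])
    rw [show u + -c + (c + s) = u + s by ring] at h2
    have h3 := mul_le_mul_of_nonneg_left h1 (Nat.cast_nonneg (α := ℝ) N)
    nlinarith [hW_pos u]

/-- A Potter-type bound for continuous functions dominated by a (possibly nonmeasurable) function
with exponential decay rate `α`. -/
lemma exists_potter_bound {α β : ℝ} (hβ : 0 ≤ β) (hβα : β < α) {W : ℝ → ℝ} (hW_pos : ∀ u, 0 < W u)
    (hW : ∀ s, Tendsto (fun u => W (u + s) / W u) atTop (𝓝 (Real.exp (-α * s))))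
    {C₀ : ℝ} (hC₀ : 0 ≤ C₀) (u₀ R : ℝ) :
    ∃ C ≥ (0 : ℝ), ∃ u₁ : ℝ, ∀ k : ℝ → ℝ, Continuous k → (∀ u ≥ u₀, k u ≤ C₀ * W u) →
      ∀ u ≥ u₁, ∀ v ≥ -R, k (u + v) ≤ C * Real.exp (-β * v) * W u := by
  obtain ⟨ε, hε, C, hC, u₁, D, hD, hDW⟩ := exists_shift_bound_on_dense hW_pos hW
  set η := ε / 2 with hη
  have hη_pos : 0 < η := by positivity
  have hlocal (k : ℝ → ℝ) (hk : Continuous k) (hkW : ∀ u ≥ u₀, k u ≤ C₀ * W u)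
      (u : ℝ) (hu : u ≥ max u₁ (u₀ + ε)) (v : ℝ) (hv : v ∈ Set.Ico 0 η) :
      k (u + v) ≤ C₀ * C * W u := by
    have hvb : v ∈ Metric.ball (0 : ℝ) ε := by
      rw [Metric.mem_ball, dist_zero_right, Real.norm_of_nonneg hv.1]
      linarith [hv.2]
    have hmem : v ∈ closure (D ∩ Metric.ball 0 ε) := by
      have := Metric.isOpen_ball.inter_closure (t := D) ⟨hvb, hD hvb⟩
      rwa [Set.inter_comm] at this
    have hclosed : IsClosed {v : ℝ | k (u + v) ≤ C₀ * C * W u} :=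
      isClosed_le (by fun_prop) continuous_const
    refine closure_minimal ?_ hclosed hmem
    rintro s ⟨hs, hsb⟩
    rw [Metric.mem_ball, dist_zero_right, Real.norm_eq_abs, abs_lt] at hsb
    have h1 := hkW (u + s) (by linarith [le_max_right u₁ (u₀ + ε)])
    have h2 := hDW s hs u ((le_max_left _ _).trans hu)
    calc k (u + s) ≤ C₀ * W (u + s) := h1
      _ ≤ C₀ * (C * W u) := by gcongr
      _ = C₀ * C * W u := by ring
  obtain ⟨u₂, hu₂⟩ : ∃ u₂ : ℝ, ∀ u ≥ u₂, W (u + η) ≤ Real.exp (-β * η) * W u := by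
    have h := (hW η).eventually_lt_const (u := Real.exp (-β * η))
      (Real.exp_lt_exp.2 (by nlinarith))
    obtain ⟨a, ha⟩ := eventually_atTop.1 h
    exact ⟨a, fun u hu => ((div_lt_iff₀ (hW_pos u)).1 (ha u hu)).le⟩
  have hiter (u : ℝ) (hu : u ≥ u₂) (j : ℕ) :
      W (u + j * η) ≤ Real.exp (-β * (j * η)) * W u := by
    induction j with
    | zero => simp
    | succ j ih =>
      have h1 := hu₂ (u + j * η) (by nlinarith [Nat.cast_nonneg (α := ℝ) j])
      calc W (u + (j + 1 : ℕ) * η) = W (u + j * η + η) := by push_cast; ring_nf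
        _ ≤ Real.exp (-β * η) * W (u + j * η) := h1
        _ ≤ Real.exp (-β * η) * (Real.exp (-β * (j * η)) * W u) := by gcongr
        _ = Real.exp (-β * ((j + 1 : ℕ) * η)) * W u := by
          rw [← mul_assoc, ← Real.exp_add]; push_cast; ring_nf
  obtain ⟨M, u₃, hM, hu₃⟩ : ∃ M u₃ : ℝ, 0 ≤ M ∧ ∀ u ≥ u₃, W (u + -R) ≤ M * W u := by
    obtain ⟨a, ha⟩ := eventually_atTop.1 ((hW (-R)).eventually_lt_const (lt_add_one _))
    exact ⟨_, a, by positivity, fun u hu => ((div_lt_iff₀ (hW_pos u)).1 (ha u hu)).le⟩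
  refine ⟨C₀ * C * Real.exp (β * η) * Real.exp (-β * R) * M, by positivity,
    max u₃ (max u₂ (max u₁ (u₀ + ε)) + R), fun k hk hkW u hu v hv => ?_⟩
  have hu3 : u ≥ u₃ := (le_max_left _ _).trans hu
  have huR : u + -R ≥ max u₂ (max u₁ (u₀ + ε)) := by
    linarith [(le_max_right u₃ (max u₂ (max u₁ (u₀ + ε)) + R)).trans hu]
  have hw : 0 ≤ (v + R) / η := div_nonneg (by linarith) hη_pos.le
  set j := ⌊(v + R) / η⌋₊ with hj
  have hj1 : j * η ≤ v + R := (le_div_iff₀ hη_pos).1 (Nat.floor_le hw)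
  have hj2 : v + R < (j + 1) * η := (div_lt_iff₀ hη_pos).1 (Nat.lt_floor_add_one _)
  have h1 := hlocal k hk hkW (u + -R + j * η)
    (((le_max_right _ _).trans huR).trans (by nlinarith [Nat.cast_nonneg (α := ℝ) j]))
    (v + R - j * η) ⟨by linarith, by linarith⟩
  have h2 := hiter (u + -R) ((le_max_left _ _).trans huR) j
  calc k (u + v) = k (u + -R + j * η + (v + R - j * η)) := by ring_nf
    _ ≤ C₀ * C * W (u + -R + j * η) := h1
    _ ≤ C₀ * C * (Real.exp (β * η + -β * R + -β * v) * (M * W u)) := by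
      gcongr
      refine h2.trans ?_
      gcongr
      · exact (hW_pos _).le
      · nlinarith
      · exact hu₃ u hu3
    _ = _ := by rw [Real.exp_add, Real.exp_add]; ring

/-- The scaled density is bounded on the unit sphere. -/
lemma exists_sphere_bound {E : Type*} [NormedAddCommGroup E] [NormedSpace ℝ E] [ProperSpace E]
    {f q : E → ℝ} (hf : Continuous f) {a : ℝ → ℝ}
    (hq_unif : ∀ δ > (0 : ℝ), ∃ t₀ > (0 : ℝ), ∀ t ≥ t₀, ∀ z : E, ‖z‖ = 1 →
      |f (t • z) / a t - q z| ≤ δ) :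
    ∃ C ≥ (0 : ℝ), ∃ t₀ > (0 : ℝ), ∀ t ≥ t₀, ∀ z : E, ‖z‖ = 1 → f (t • z) / a t ≤ C := by
  obtain ⟨t₀, ht₀, h⟩ := hq_unif 1 one_pos
  obtain ⟨K, hK⟩ := (isCompact_sphere (0 : E) 1).exists_bound_of_continuousOn
    (f := fun z => f (t₀ • z) / a t₀) (by fun_prop)
  refine ⟨max 0 (K + 2), le_max_left _ _, t₀, ht₀, fun t ht z hz => ?_⟩
  have h1 := abs_le.1 (h t₀ le_rfl z hz)
  have h2 := abs_le.1 (h t ht z hz)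
  have h3 := (le_abs_self _).trans (hK z (by simpa using hz))
  exact le_trans (by linarith) (le_max_right _ _)

/-- A negative power of the norm, of exponent exceeding the dimension, is integrable away from the
origin. -/
lemma integrableOn_norm_rpow_neg {E : Type*} [NormedAddCommGroup E] [NormedSpace ℝ E]
    [FiniteDimensional ℝ E] [MeasurableSpace E] [BorelSpace E] (μ : Measure E)
    [μ.IsAddHaarMeasure] {p : ℝ} (hp : (Module.finrank ℝ E : ℝ) < p) {B : Set E}
    (hB : MeasurableSet B) {r : ℝ} (hr : 0 < r) (hBr : ∀ z ∈ B, r ≤ ‖z‖) :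
    IntegrableOn (fun z => ‖z‖ ^ (-p)) B μ := by
  have hp0 : 0 ≤ p := (Nat.cast_nonneg _).trans hp.le
  refine Integrable.mono' ((integrable_one_add_norm (μ := μ) hp).const_mul
    ((1 + r⁻¹) ^ p)).integrableOn
    (measurable_norm.pow_const _).aestronglyMeasurable ?_
  filter_upwards [ae_restrict_mem hB] with z hz
  have hz0 : 0 < ‖z‖ := hr.trans_le (hBr z hz)
  rw [Real.norm_of_nonneg (by positivity)]
  have h : 1 + ‖z‖ ≤ (1 + r⁻¹) * ‖z‖ := by
    have : 1 ≤ r⁻¹ * ‖z‖ := by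
      rw [← div_eq_inv_mul]; exact (one_le_div hr).2 (hBr z hz)
    linarith
  calc ‖z‖ ^ (-p) = (1 + r⁻¹) ^ p * ((1 + r⁻¹) * ‖z‖) ^ (-p) := by
        rw [Real.mul_rpow (by positivity) hz0.le, ← mul_assoc, ← Real.rpow_add (by positivity)]
        simp
    _ ≤ (1 + r⁻¹) ^ p * (1 + ‖z‖) ^ (-p) := by
      gcongr ?_ * ?_
      exact Real.rpow_le_rpow_of_nonpos (by positivity) h (by linarith)

/-- The scaled density is dominated by a power of the norm away from the origin. -/
lemma exists_scaled_density_bound {E : Type*} [NormedAddCommGroup E] [NormedSpace ℝ E]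
    [ProperSpace E] {d α β : ℝ} (hβ : 0 ≤ β) (hβα : β < α) {f q : E → ℝ} (hf : Continuous f)
    {V : ℝ → ℝ} (hV_pos : ∀ t > (0 : ℝ), 0 < V t)
    (hV_rv : ∀ x > (0 : ℝ), Tendsto (fun t => V (t * x) / V t) atTop (𝓝 (x ^ (-α))))
    (hq_unif : ∀ δ > (0 : ℝ), ∃ t₀ > (0 : ℝ), ∀ t ≥ t₀, ∀ z : E, ‖z‖ = 1 →
      |f (t • z) / (t ^ (-d) * V t) - q z| ≤ δ) {r : ℝ} (hr : 0 < r) :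
    ∃ C : ℝ, ∀ᶠ t : ℝ in atTop, ∀ z : E, r ≤ ‖z‖ →
      f (t • z) / (t ^ (-d) * V t) ≤ C * ‖z‖ ^ (-(d + β)) := by
  obtain ⟨C₀, hC₀, t₀, ht₀, hsph⟩ := exists_sphere_bound hf hq_unif
  have hW (s : ℝ) : Tendsto (fun u => V (Real.exp (u + s)) / V (Real.exp u)) atTop
      (𝓝 (Real.exp (-α * s))) := by
    have h := (hV_rv (Real.exp s) (Real.exp_pos s)).comp Real.tendsto_exp_atTop
    rw [← Real.exp_mul, mul_comm s] at h
    simpa only [Function.comp_def, ← Real.exp_add] using h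
  obtain ⟨C, -, u₁, hpot⟩ := exists_potter_bound hβ hβα (W := fun u => V (Real.exp u))
    (fun u => hV_pos _ (Real.exp_pos u)) hW hC₀ (Real.log t₀) (-Real.log r)
  refine ⟨C, ?_⟩
  filter_upwards [eventually_ge_atTop (Real.exp u₁)] with t ht z hz
  have ht0 : 0 < t := (Real.exp_pos _).trans_le ht
  have hz0 : 0 < ‖z‖ := hr.trans_le hz
  have hθ : ‖‖z‖⁻¹ • z‖ = 1 := by rw [norm_smul, norm_inv, norm_norm, inv_mul_cancel₀ hz0.ne']
  have key := hpot (fun u => Real.exp (d * u) * f (Real.exp u • (‖z‖⁻¹ • z))) (by fun_prop) ?_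
    (Real.log t) ((Real.le_log_iff_exp_le ht0).2 ht) (Real.log ‖z‖)
    (by simpa using Real.log_le_log hr hz)
  · have hpow : Real.exp (d * (Real.log t + Real.log ‖z‖)) = t ^ d * ‖z‖ ^ d := by
      rw [Real.rpow_def_of_pos ht0, Real.rpow_def_of_pos hz0, ← Real.exp_add]; ring_nf
    have hexp : Real.exp (-β * Real.log ‖z‖) = ‖z‖ ^ (-β) := by
      rw [Real.rpow_def_of_pos hz0]; ring_nf
    have harg : Real.exp (Real.log t + Real.log ‖z‖) • (‖z‖⁻¹ • z) = t • z := by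
      rw [Real.exp_add, Real.exp_log ht0, Real.exp_log hz0, smul_smul, mul_assoc,
        mul_inv_cancel₀ hz0.ne', mul_one]
    simp only [hpow, hexp, harg, Real.exp_log ht0] at key
    have hVt := hV_pos t ht0
    have htd : 0 < t ^ d := Real.rpow_pos_of_pos ht0 d
    have hzd : 0 < ‖z‖ ^ d := Real.rpow_pos_of_pos hz0 d
    rw [div_le_iff₀ (by positivity), neg_add, Real.rpow_add hz0, Real.rpow_neg ht0.le,
      Real.rpow_neg hz0.le d]
    calc f (t • z) = (t ^ d * ‖z‖ ^ d)⁻¹ * (t ^ d * ‖z‖ ^ d * f (t • z)) := by field_simp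
      _ ≤ (t ^ d * ‖z‖ ^ d)⁻¹ * (C * ‖z‖ ^ (-β) * V t) := by gcongr
      _ = C * ((‖z‖ ^ d)⁻¹ * ‖z‖ ^ (-β)) * ((t ^ d)⁻¹ * V t) := by rw [mul_inv]; ring
  · intro u hu
    have hVu := hV_pos _ (Real.exp_pos u)
    have h := hsph (Real.exp u) ((Real.log_le_iff_le_exp ht₀).1 hu) _ hθ
    rw [div_le_iff₀ (by positivity), ← Real.exp_mul] at h
    calc Real.exp (d * u) * f (Real.exp u • (‖z‖⁻¹ • z))
        ≤ Real.exp (d * u) * (C₀ * (Real.exp (u * -d) * V (Real.exp u))) := by gcongr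
      _ = C₀ * (Real.exp (d * u + u * -d) * V (Real.exp u)) := by rw [Real.exp_add]; ring
      _ = C₀ * V (Real.exp u) := by ring_nf; simp

/-- The probability of a dilated set, as an integral of the dilated density. -/
lemma withDensity_smul_set_toReal {E : Type*} [NormedAddCommGroup E] [NormedSpace ℝ E]
    [FiniteDimensional ℝ E] [MeasurableSpace E] [BorelSpace E] (μ : Measure E)
    [μ.IsAddHaarMeasure] {f : E → ℝ} (hf : Continuous f) (hf_nonneg : ∀ z, 0 ≤ f z) {B : Set E}
    (hB : MeasurableSet B) {t : ℝ} (ht : 0 < t) :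
    (μ.withDensity (fun z => ENNReal.ofReal (f z)) (t • B)).toReal =
      t ^ Module.finrank ℝ E * ∫ z in B, f (t • z) ∂μ := by
  rw [withDensity_apply _ (hB.const_smul_of_ne_zero ht.ne'),
    ← integral_eq_lintegral_of_nonneg_ae (ae_of_all _ hf_nonneg) hf.aestronglyMeasurable,
    Measure.setIntegral_comp_smul_of_pos μ f B ht, smul_eq_mul, mul_inv_cancel_left₀]
  positivity



/-- For every Borel set `B ⊆ ℝ^d` bounded away from the origin,
`lim_{t→∞} P(X ∈ tB)/V(t) = ∫_B q(z) dz`, and this integral is finite. -/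
theorem extreme_risk_set_convergence
    (d : ℕ) (hd : 2 ≤ d)
    (P : Measure (EuclideanSpace ℝ (Fin d))) [IsProbabilityMeasure P]
    (f : EuclideanSpace ℝ (Fin d) → ℝ)
    (hf_cont : Continuous f) (hf_pos : ∀ z, 0 < f z)
    (hP : P = volume.withDensity (fun z => ENNReal.ofReal (f z)))
    (α : ℝ) (hα : 0 < α)
    (V : ℝ → ℝ) (hV_pos : ∀ t > (0 : ℝ), 0 < V t)
    (hV_rv : ∀ x > (0 : ℝ),
      Tendsto (fun t => V (t * x) / V t) atTop (𝓝 (x ^ (-α))))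
    (q : EuclideanSpace ℝ (Fin d) → ℝ)
    (hq_nonneg : ∀ z : EuclideanSpace ℝ (Fin d), z ≠ 0 → 0 ≤ q z)
    (hq_lim : ∀ z : EuclideanSpace ℝ (Fin d), z ≠ 0 →
      Tendsto (fun t : ℝ => f (t • z) / (t ^ (-(d : ℝ)) * V t)) atTop (𝓝 (q z)))
    (hq_unif : ∀ δ > (0 : ℝ), ∃ t₀ > (0 : ℝ), ∀ t ≥ t₀,
      ∀ z : EuclideanSpace ℝ (Fin d), ‖z‖ = 1 →
        |f (t • z) / (t ^ (-(d : ℝ)) * V t) - q z| ≤ δ)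
    (B : Set (EuclideanSpace ℝ (Fin d))) (hB_meas : MeasurableSet B)
    (hB_away : ∃ r > (0 : ℝ), ∀ z ∈ B, r ≤ ‖z‖) :
    IntegrableOn q B volume ∧
    Tendsto (fun t : ℝ => (P (t • B)).toReal / V t) atTop (𝓝 (∫ z in B, q z)) := by
  obtain ⟨r, hr, hBr⟩ := hB_away
  obtain ⟨C, hC⟩ := exists_scaled_density_bound (half_pos hα).le (half_lt_self hα) hf_cont hV_pos
    hV_rv hq_unif hr
  have hg : IntegrableOn (fun z : EuclideanSpace ℝ (Fin d) => C * ‖z‖ ^ (-((d : ℝ) + α / 2))) B :=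
    (integrableOn_norm_rpow_neg volume (by simpa using hα) hB_meas hr hBr).const_mul C
  have hlim : ∀ᵐ z ∂(volume.restrict B),
      Tendsto (fun t : ℝ => f (t • z) / (t ^ (-(d : ℝ)) * V t)) atTop (𝓝 (q z)) := by
    filter_upwards [ae_restrict_mem hB_meas] with z hz
    exact hq_lim z (norm_pos_iff.1 (hr.trans_le (hBr z hz)))
  have hmeas (t : ℝ) : AEStronglyMeasurable
      (fun z : EuclideanSpace ℝ (Fin d) => f (t • z) / (t ^ (-(d : ℝ)) * V t))
      (volume.restrict B) :=
    Continuous.aestronglyMeasurable (by fun_prop)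
  have hbound : ∀ᶠ t : ℝ in atTop, ∀ᵐ z ∂(volume.restrict B),
      ‖f (t • z) / (t ^ (-(d : ℝ)) * V t)‖ ≤ C * ‖z‖ ^ (-((d : ℝ) + α / 2)) := by
    filter_upwards [hC, eventually_gt_atTop 0] with t ht ht0
    filter_upwards [ae_restrict_mem hB_meas] with z hz
    have := hV_pos t ht0
    have := hf_pos (t • z)
    rw [Real.norm_of_nonneg (by positivity)]
    exact ht z (hBr z hz)
  constructor
  · refine Integrable.mono' hg (aestronglyMeasurable_of_tendsto_ae atTop hmeas hlim) ?_
    filter_upwards [ae_restrict_mem hB_meas, hlim] with z hz hz_lim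
    refine le_of_tendsto hz_lim.norm ?_
    filter_upwards [hC, eventually_gt_atTop 0] with t ht ht0
    have := hV_pos t ht0
    have := hf_pos (t • z)
    rw [Real.norm_of_nonneg (by positivity)]
    exact ht z (hBr z hz)
  · refine (tendsto_integral_filter_of_dominated_convergence _ (Eventually.of_forall hmeas) hbound
      hg hlim).congr' ?_
    filter_upwards [eventually_gt_atTop 0] with t ht
    rw [hP, withDensity_smul_set_toReal volume hf_cont (fun z => (hf_pos z).le) hB_meas ht,
      integral_div, finrank_euclideanSpace_fin, Real.rpow_neg ht.le, Real.rpow_natCast]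
    have := hV_pos t ht
    field_simp
end

section
/- Let l = 1/∫_{‖z‖≥1} q(z) dz, where this integral is assumed to lie in (0,∞), and define q_t(z) = t (U(t))^d f(U(t) z). Then for every ε > 0, lim_{t→∞} sup_{‖z‖ ≥ ε} | q_t(z) − l·q(z) | = 0. -/
open MeasureTheory Filter Topology

lemma eventually_forall_of_isCompact {X Y : Type*} [TopologicalSpace Y] {l : Filter X}
    {K : Set Y} (hK : IsCompact K) {p : X → Y → Prop}
    (h : ∀ y ∈ K, ∀ᶠ z : X × Y in l ×ˢ 𝓝 y, p z.1 z.2) : ∀ᶠ x in l, ∀ y ∈ K, p x y :=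
  (show ∀ᶠ z : X × Y in l ×ˢ 𝓝ˢ K, p z.1 z.2 from
    hK.mem_prod_nhdsSet_of_forall h).curry.mono fun _ h => h.self_of_nhdsSet

lemma tendsto_sub_of_continuous {k : ℝ → ℝ} (hk : Continuous k)
    (h : ∀ u, Tendsto (fun x => k (x + u) - k x) atTop (𝓝 0)) (u₀ : ℝ) :
    Tendsto (fun p : ℝ × ℝ => k (p.1 + p.2) - k p.1) (atTop ×ˢ 𝓝 u₀) (𝓝 0) := by
  rw [Metric.tendsto_nhds]
  intro δ hδ
  let A : ℕ → Set ℝ := fun n => {u | ∀ x ≥ (n : ℝ), |k (x + u) - k x| ≤ δ / 4}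
  have hA_closed : ∀ n, IsClosed (A n) := by
    intro n
    simp only [A, Set.ofPred_forall]
    refine isClosed_iInter fun x => isClosed_iInter fun _ => ?_
    exact isClosed_le (by fun_prop) (by fun_prop)
  have hA_univ : ⋃ n, A n = Set.univ := by
    refine Set.eq_univ_of_forall fun u => Set.mem_iUnion.2 ?_
    obtain ⟨x₀, hx₀⟩ := eventually_atTop.1
      ((Metric.tendsto_nhds.1 (h u)) (δ / 4) (by positivity))
    obtain ⟨n, hn⟩ := exists_nat_ge x₀
    refine ⟨n, fun x hx => ?_⟩
    simpa using (hx₀ x (hn.trans hx)).le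
  obtain ⟨n, a, ha⟩ := nonempty_interior_of_iUnion_of_closed hA_closed hA_univ
  have hnear : ∀ᶠ u in 𝓝 u₀, u - u₀ + a ∈ A n := by
    have : Tendsto (fun u => u - u₀ + a) (𝓝 u₀) (𝓝 a) := by
      have : Continuous fun u : ℝ => u - u₀ + a := by fun_prop
      simpa using this.tendsto u₀
    exact this.eventually (mem_interior_iff_mem_nhds.1 ha)
  have hfar : ∀ᶠ x in atTop, |k (x + (u₀ - a)) - k x| < δ / 4 ∧ (n : ℝ) ≤ x + (u₀ - a) := by
    refine Eventually.and ?_ ?_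
    · simpa using (Metric.tendsto_nhds.1 (h (u₀ - a))) (δ / 4) (by positivity)
    · exact (tendsto_atTop_add_const_right _ _ tendsto_id).eventually_ge_atTop _
  filter_upwards [hfar.prod_mk hnear] with p ⟨⟨h1, h2⟩, h3⟩
  have h4 := h3 _ h2
  have : p.1 + (u₀ - a) + (p.2 - u₀ + a) = p.1 + p.2 := by ring
  rw [this] at h4
  rw [Real.dist_eq, sub_zero]
  have := abs_sub_le (k (p.1 + p.2)) (k (p.1 + (u₀ - a))) (k p.1)
  linarith

lemma tendsto_fst_add_snd_atTop (u₀ : ℝ) :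
    Tendsto (fun p : ℝ × ℝ => p.1 + p.2) (atTop ×ˢ 𝓝 u₀) atTop :=
  tendsto_fst.atTop_add tendsto_snd

lemma tendsto_sub_of_asymp_continuous {h k : ℝ → ℝ} (hk : Continuous k) {c : ℝ}
    (hhk : Tendsto (fun x => h x - k x) atTop (𝓝 c))
    (hh : ∀ u, Tendsto (fun x => h (x + u) - h x) atTop (𝓝 0)) (u₀ : ℝ) :
    Tendsto (fun p : ℝ × ℝ => h (p.1 + p.2) - h p.1) (atTop ×ˢ 𝓝 u₀) (𝓝 0) := by
  have hk' : ∀ u, Tendsto (fun x => k (x + u) - k x) atTop (𝓝 0) := by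
    intro u
    have h1 := hhk.comp (tendsto_atTop_add_const_right atTop u tendsto_id)
    have := ((hh u).sub h1).add hhk
    rw [zero_sub, neg_add_cancel] at this
    refine this.congr fun x => ?_
    simp only [Function.comp_apply, id]
    ring
  have h1 := hhk.comp (tendsto_fst_add_snd_atTop u₀)
  have h2 : Tendsto (fun p : ℝ × ℝ => h p.1 - k p.1) (atTop ×ˢ 𝓝 u₀) (𝓝 c) :=
    hhk.comp tendsto_fst
  have := ((tendsto_sub_of_continuous hk hk' u₀).add h1).sub h2
  rw [zero_add, sub_self] at this
  refine this.congr fun x => ?_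
  simp only [Function.comp_apply]
  ring

lemma exists_forall_sub_le_mul_add_one {h : ℝ → ℝ}
    (hh : ∀ u, Tendsto (fun p : ℝ × ℝ => h (p.1 + p.2) - h p.1) (atTop ×ˢ 𝓝 u) (𝓝 0))
    {δ : ℝ} (hδ : 0 < δ) :
    ∃ x₀, ∀ x ≥ x₀, ∀ u ≥ 0, h (x + u) - h x ≤ δ * (u + 1) := by
  have hunif : ∀ᶠ x in atTop, ∀ u ∈ Set.Icc (0 : ℝ) 1, h (x + u) - h x ≤ δ := by
    refine eventually_forall_of_isCompact isCompact_Icc fun u _ => ?_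
    exact (hh u).eventually_le_const hδ
  obtain ⟨x₀, hx₀⟩ := eventually_atTop.1 hunif
  have hstep : ∀ n : ℕ, ∀ x ≥ x₀, h (x + n) - h x ≤ δ * n := by
    intro n
    induction n with
    | zero => intro x _; simp
    | succ n ih =>
      intro x hx
      have h1 := ih x hx
      have h2 := hx₀ (x + n) (hx.trans (by simp)) 1 (by simp)
      push_cast
      rw [← add_assoc]
      linarith
  refine ⟨x₀, fun x hx u hu => ?_⟩
  have h1 := hstep ⌊u⌋₊ x hx
  have h2 := hx₀ (x + ⌊u⌋₊) (hx.le.trans (by simp)) (u - ⌊u⌋₊)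
    ⟨sub_nonneg.2 (Nat.floor_le hu), by linarith [Nat.lt_floor_add_one u]⟩
  have h3 : x + ⌊u⌋₊ + (u - ⌊u⌋₊) = x + u := by ring
  rw [h3] at h2
  nlinarith [Nat.floor_le hu]

section RegularVariation

variable {α : ℝ} {V : ℝ → ℝ}

lemma div_eq_exp_sub_mul_rpow (hV_pos : ∀ t > 0, 0 < V t) {s r : ℝ} (hs : 0 < s) (hr : 0 < r) :
    V (s * r) / V s =
      Real.exp ((Real.log (V (Real.exp (Real.log s + Real.log r))) + α * (Real.log s + Real.log r))
        - (Real.log (V (Real.exp (Real.log s))) + α * Real.log s)) * r ^ (-α) := by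
  have h1 := hV_pos _ (mul_pos hs hr)
  have h2 := hV_pos _ hs
  rw [Real.exp_add, Real.exp_log hs, Real.exp_log hr, Real.rpow_def_of_pos hr, ← Real.exp_add,
    ← Real.exp_log (div_pos h1 h2), Real.log_div h1.ne' h2.ne']
  congr 1
  ring

lemma tendsto_log_sub (hV_pos : ∀ t > 0, 0 < V t)
    (hV_rv : ∀ x > 0, Tendsto (fun t => V (t * x) / V t) atTop (𝓝 (x ^ (-α))))
    {W : ℝ → ℝ} (hW_cont : Continuous W) (hW_pos : ∀ t > 0, 0 < W t) {c : ℝ} (hc : 0 < c)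
    (hWV : Tendsto (fun t => W t / V t) atTop (𝓝 c)) (u₀ : ℝ) :
    Tendsto (fun p : ℝ × ℝ => (Real.log (V (Real.exp (p.1 + p.2))) + α * (p.1 + p.2))
      - (Real.log (V (Real.exp p.1)) + α * p.1)) (atTop ×ˢ 𝓝 u₀) (𝓝 0) := by
  have hk : Continuous fun x => Real.log (W (Real.exp x)) + α * x :=
    (Continuous.log (by fun_prop) fun x => (hW_pos _ (Real.exp_pos x)).ne').add (by fun_prop)
  refine tendsto_sub_of_asymp_continuous (h := fun x => Real.log (V (Real.exp x)) + α * x)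
    hk (c := -Real.log c) ?_ (fun u => ?_) u₀
  · refine ((hWV.comp Real.tendsto_exp_atTop).log hc.ne').neg.congr fun x => ?_
    have h1 := hV_pos _ (Real.exp_pos x)
    have h2 := hW_pos _ (Real.exp_pos x)
    simp only [Function.comp_apply]
    rw [Real.log_div h2.ne' h1.ne']
    ring
  · have h1 := ((hV_rv _ (Real.exp_pos u)).comp Real.tendsto_exp_atTop).log
      (Real.rpow_pos_of_pos (Real.exp_pos u) _).ne'
    rw [← Real.exp_mul, Real.log_exp] at h1
    have h2 := h1.add_const (α * u)
    rw [show u * -α + α * u = 0 by ring] at h2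
    refine h2.congr fun x => ?_
    have h1 := hV_pos _ (Real.exp_pos x)
    have h2 := hV_pos _ (Real.exp_pos (x + u))
    simp only [Function.comp_apply]
    rw [← Real.exp_add, Real.log_div h2.ne' h1.ne']
    ring

/-- Locally uniform convergence for a regularly varying function that is asymptotically
equivalent to a continuous function. -/
lemma tendsto_div_of_regularlyVarying (hV_pos : ∀ t > 0, 0 < V t)
    (hV_rv : ∀ x > 0, Tendsto (fun t => V (t * x) / V t) atTop (𝓝 (x ^ (-α))))
    {W : ℝ → ℝ} (hW_cont : Continuous W) (hW_pos : ∀ t > 0, 0 < W t) {c : ℝ} (hc : 0 < c)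
    (hWV : Tendsto (fun t => W t / V t) atTop (𝓝 c)) {r : ℝ} (hr : 0 < r) :
    Tendsto (fun p : ℝ × ℝ => V (p.1 * p.2) / V p.1) (atTop ×ˢ 𝓝 r) (𝓝 (r ^ (-α))) := by
  have h1 : Tendsto (fun p : ℝ × ℝ => (Real.log p.1, Real.log p.2)) (atTop ×ˢ 𝓝 r)
      (atTop ×ˢ 𝓝 (Real.log r)) :=
    (Real.tendsto_log_atTop.comp tendsto_fst).prodMk
      ((Real.continuousAt_log hr.ne').tendsto.comp tendsto_snd)
  have h2 := (Real.continuous_exp.tendsto 0).comp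
    ((tendsto_log_sub hV_pos hV_rv hW_cont hW_pos hc hWV (Real.log r)).comp h1)
  have h3 : Tendsto (fun p : ℝ × ℝ => p.2 ^ (-α)) (atTop ×ˢ 𝓝 r) (𝓝 (r ^ (-α))) :=
    (Real.continuousAt_rpow_const r (-α) (.inl hr.ne')).tendsto.comp tendsto_snd
  have h4 := h2.mul h3
  rw [Real.exp_zero, one_mul] at h4
  refine h4.congr' ?_
  filter_upwards [(eventually_gt_atTop (0 : ℝ)).prod_mk (lt_mem_nhds hr)] with p ⟨hp1, hp2⟩
  exact (div_eq_exp_sub_mul_rpow hV_pos hp1 hp2).symm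

/-- A one-sided Potter bound. -/
lemma exists_div_le_rpow_of_regularlyVarying (hα : 0 < α) (hV_pos : ∀ t > 0, 0 < V t)
    (hV_rv : ∀ x > 0, Tendsto (fun t => V (t * x) / V t) atTop (𝓝 (x ^ (-α))))
    {W : ℝ → ℝ} (hW_cont : Continuous W) (hW_pos : ∀ t > 0, 0 < W t) {c : ℝ} (hc : 0 < c)
    (hWV : Tendsto (fun t => W t / V t) atTop (𝓝 c)) :
    ∃ C > 0, ∀ᶠ s in atTop, ∀ r ≥ 1, V (s * r) / V s ≤ C * r ^ (-(α / 2)) := by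
  obtain ⟨x₀, hx₀⟩ := exists_forall_sub_le_mul_add_one
    (h := fun x => Real.log (V (Real.exp x)) + α * x)
    (tendsto_log_sub hV_pos hV_rv hW_cont hW_pos hc hWV) (half_pos hα)
  refine ⟨Real.exp (α / 2), Real.exp_pos _, ?_⟩
  filter_upwards [eventually_gt_atTop 0, Real.tendsto_log_atTop.eventually_ge_atTop x₀]
    with s hs hs' r hr
  have hr0 : 0 < r := by linarith
  rw [div_eq_exp_sub_mul_rpow (α := α) hV_pos hs hr0, Real.rpow_def_of_pos hr0,
    Real.rpow_def_of_pos hr0, ← Real.exp_add, ← Real.exp_add, Real.exp_le_exp]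
  have := hx₀ _ hs' _ (Real.log_nonneg hr)
  linarith

end RegularVariation

section Density

variable {E : Type*} [NormedAddCommGroup E] [NormedSpace ℝ E]
  {f q : E → ℝ} {V : ℝ → ℝ} {α d : ℝ}

lemma div_eq_radial_mul (hV_pos : ∀ t > 0, 0 < V t) {s : ℝ} (hs : 0 < s) {z : E} (hz : z ≠ 0) :
    f (s • z) / (s ^ (-d) * V s) =
      f ((s * ‖z‖) • (‖z‖⁻¹ • z)) / ((s * ‖z‖) ^ (-d) * V (s * ‖z‖)) *
        (V (s * ‖z‖) / V s) * ‖z‖ ^ (-d) := by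
  have hz' : 0 < ‖z‖ := norm_pos_iff.2 hz
  have h1 := hV_pos _ hs
  have h2 := hV_pos _ (mul_pos hs hz')
  have h3 := Real.rpow_pos_of_pos hs (-d)
  have h4 := Real.rpow_pos_of_pos hz' (-d)
  rw [smul_smul, mul_inv_cancel_right₀ hz'.ne', Real.mul_rpow hs.le hz'.le]
  field_simp

lemma norm_inv_norm_smul {z : E} (hz : z ≠ 0) : ‖‖z‖⁻¹ • z‖ = 1 := by
  simpa using norm_smul_inv_norm (𝕜 := ℝ) hz

lemma eq_radial_mul_of_tendsto (hV_pos : ∀ t > 0, 0 < V t)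
    (hV_rv : ∀ x > 0, Tendsto (fun t => V (t * x) / V t) atTop (𝓝 (x ^ (-α))))
    (hq_lim : ∀ z : E, z ≠ 0 →
      Tendsto (fun t : ℝ => f (t • z) / (t ^ (-d) * V t)) atTop (𝓝 (q z)))
    {z : E} (hz : z ≠ 0) : q z = q (‖z‖⁻¹ • z) * ‖z‖ ^ (-α) * ‖z‖ ^ (-d) := by
  have hz' : 0 < ‖z‖ := norm_pos_iff.2 hz
  have h0 : ‖z‖⁻¹ • z ≠ 0 := smul_ne_zero (inv_ne_zero hz'.ne') hz
  refine tendsto_nhds_unique (hq_lim z hz) ?_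
  refine ((((hq_lim _ h0).comp (tendsto_id.atTop_mul_const hz')).mul
    (hV_rv _ hz')).mul_const (‖z‖ ^ (-d))).congr' ?_
  filter_upwards [eventually_gt_atTop 0] with s hs
  exact (div_eq_radial_mul hV_pos hs hz).symm

lemma continuousOn_sphere_of_unif (hf : Continuous f)
    (hq_unif : ∀ δ > (0 : ℝ), ∃ t₀ > (0 : ℝ), ∀ t ≥ t₀, ∀ z : E, ‖z‖ = 1 →
      |f (t • z) / (t ^ (-d) * V t) - q z| ≤ δ) :
    ContinuousOn q (Metric.sphere 0 1) := by
  have h : TendstoUniformlyOn (fun (t : ℝ) z => f (t • z) / (t ^ (-d) * V t)) q atTop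
      (Metric.sphere 0 1) := by
    rw [Metric.tendstoUniformlyOn_iff]
    intro δ hδ
    obtain ⟨t₀, -, ht₀⟩ := hq_unif (δ / 2) (half_pos hδ)
    filter_upwards [eventually_ge_atTop t₀] with t ht z hz
    rw [dist_comm, Real.dist_eq]
    exact (ht₀ t ht z (by simpa using hz)).trans_lt (half_lt_self hδ)
  exact h.continuousOn (Frequently.of_forall fun t => by fun_prop)

lemma tendsto_inv_norm_smul {z₀ : E} (hz₀ : z₀ ≠ 0) :
    Tendsto (fun z : E => ‖z‖⁻¹ • z) (𝓝 z₀)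
      (𝓝[Metric.sphere 0 1] (‖z₀‖⁻¹ • z₀)) := by
  refine tendsto_nhdsWithin_iff.2 ⟨?_, ?_⟩
  · exact (tendsto_norm.inv₀ (norm_ne_zero_iff.2 hz₀)).smul tendsto_id
  · filter_upwards [isOpen_ne.mem_nhds hz₀] with z hz
    simpa using norm_inv_norm_smul hz

lemma tendsto_density_sub_of_unif (hf : Continuous f) (hV_pos : ∀ t > 0, 0 < V t)
    (hV_rv : ∀ x > 0, Tendsto (fun t => V (t * x) / V t) atTop (𝓝 (x ^ (-α))))
    (hV_unif : ∀ r > 0, Tendsto (fun p : ℝ × ℝ => V (p.1 * p.2) / V p.1) (atTop ×ˢ 𝓝 r)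
      (𝓝 (r ^ (-α))))
    (hq_lim : ∀ z : E, z ≠ 0 →
      Tendsto (fun t : ℝ => f (t • z) / (t ^ (-d) * V t)) atTop (𝓝 (q z)))
    (hq_unif : ∀ δ > (0 : ℝ), ∃ t₀ > (0 : ℝ), ∀ t ≥ t₀, ∀ z : E, ‖z‖ = 1 →
      |f (t • z) / (t ^ (-d) * V t) - q z| ≤ δ) {z₀ : E} (hz₀ : z₀ ≠ 0) :
    Tendsto (fun p : ℝ × E => f (p.1 • p.2) / (p.1 ^ (-d) * V p.1) - q p.2)
      (atTop ×ˢ 𝓝 z₀) (𝓝 0) := by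
  have hz' : 0 < ‖z₀‖ := norm_pos_iff.2 hz₀
  have hne : ∀ᶠ z : E in 𝓝 z₀, z ≠ 0 := isOpen_ne.mem_nhds hz₀
  have hmem : ‖z₀‖⁻¹ • z₀ ∈ Metric.sphere (0 : E) 1 := by simpa using norm_inv_norm_smul hz₀
  have hnorm : Tendsto (fun p : ℝ × E => ‖p.2‖) (atTop ×ˢ 𝓝 z₀) (𝓝 ‖z₀‖) :=
    (continuous_norm.tendsto z₀).comp tendsto_snd
  have hpow : ∀ a : ℝ, Tendsto (fun p : ℝ × E => ‖p.2‖ ^ a) (atTop ×ˢ 𝓝 z₀) (𝓝 (‖z₀‖ ^ a)) :=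
    fun a => (Real.continuousAt_rpow_const _ a (.inl hz'.ne')).tendsto.comp hnorm
  have hq : Tendsto (fun p : ℝ × E => q (‖p.2‖⁻¹ • p.2)) (atTop ×ˢ 𝓝 z₀)
      (𝓝 (q (‖z₀‖⁻¹ • z₀))) :=
    ((continuousOn_sphere_of_unif hf hq_unif _ hmem).tendsto.comp
      (tendsto_inv_norm_smul hz₀)).comp tendsto_snd
  have hdiff : Tendsto (fun p : ℝ × E =>
      f ((p.1 * ‖p.2‖) • (‖p.2‖⁻¹ • p.2)) / ((p.1 * ‖p.2‖) ^ (-d) * V (p.1 * ‖p.2‖))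
        - q (‖p.2‖⁻¹ • p.2)) (atTop ×ˢ 𝓝 z₀) (𝓝 0) := by
    rw [Metric.tendsto_nhds]
    intro δ hδ
    obtain ⟨t₀, -, ht₀⟩ := hq_unif (δ / 2) (half_pos hδ)
    have hlarge : Tendsto (fun p : ℝ × E => p.1 * ‖p.2‖) (atTop ×ˢ 𝓝 z₀) atTop :=
      tendsto_fst.atTop_mul_pos hz' hnorm
    filter_upwards [hlarge.eventually_ge_atTop t₀, tendsto_snd.eventually hne] with p hp hp'
    rw [Real.dist_eq, sub_zero]
    exact (ht₀ _ hp _ (norm_inv_norm_smul hp')).trans_lt (half_lt_self hδ)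
  have hV := (hV_unif _ hz').comp (tendsto_fst.prodMk hnorm)
  have h1 := ((hdiff.add hq).mul hV).mul (hpow (-d))
  have h2 := (hq.mul (hpow (-α))).mul (hpow (-d))
  have h3 := h1.sub h2
  rw [zero_add, sub_self] at h3
  refine h3.congr' ?_
  filter_upwards [tendsto_snd.eventually hne, tendsto_fst.eventually (eventually_gt_atTop 0)]
    with p hp hp'
  rw [div_eq_radial_mul hV_pos hp' hp, eq_radial_mul_of_tendsto hV_pos hV_rv hq_lim hp]
  simp only [Function.comp_apply, sub_add_cancel]

lemma exists_density_le_rpow (hV_pos : ∀ t > 0, 0 < V t)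
    {C : ℝ} (hC : ∀ᶠ s in atTop, ∀ r ≥ 1, V (s * r) / V s ≤ C * r ^ (-(α / 2)))
    {M : ℝ} (hM : ∀ z, ‖z‖ = 1 → q z ≤ M) (hM0 : 0 ≤ M)
    (hq_unif : ∀ δ > (0 : ℝ), ∃ t₀ > (0 : ℝ), ∀ t ≥ t₀, ∀ z : E, ‖z‖ = 1 →
      |f (t • z) / (t ^ (-d) * V t) - q z| ≤ δ) :
    ∀ᶠ s : ℝ in atTop, ∀ z : E, 1 ≤ ‖z‖ →
      f (s • z) / (s ^ (-d) * V s) ≤ (M + 1) * C * ‖z‖ ^ (-(d + α / 2)) := by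
  obtain ⟨t₀, ht₀, h⟩ := hq_unif 1 one_pos
  filter_upwards [hC, eventually_ge_atTop t₀] with s hs hst z hz
  have hz0 : z ≠ 0 := norm_pos_iff.1 (by linarith)
  have hs0 : 0 < s := ht₀.trans_le hst
  have hz' := norm_inv_norm_smul hz0
  have h1 := (abs_le.1 (h (s * ‖z‖) (hst.trans (le_mul_of_one_le_right hs0.le hz)) _ hz')).2
  have h2 := hM _ hz'
  have h3 := hs _ hz
  have h4 := Real.rpow_nonneg (norm_nonneg z) (-d)
  have h5 : 0 ≤ V (s * ‖z‖) / V s :=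
    (div_pos (hV_pos _ (mul_pos hs0 (by linarith))) (hV_pos _ hs0)).le
  rw [div_eq_radial_mul hV_pos hs0 hz0, neg_add, Real.rpow_add (by linarith)]
  calc _ ≤ (M + 1) * (C * ‖z‖ ^ (-(α / 2))) * ‖z‖ ^ (-d) := by
        gcongr
        linarith
    _ = _ := by ring

lemma eventually_forall_abs_sub_le [ProperSpace E] (hf_pos : ∀ z, 0 < f z) (hα : 0 < α)
    (hd : 0 ≤ d) (hV_pos : ∀ t > 0, 0 < V t) (hq_nonneg : ∀ z : E, z ≠ 0 → 0 ≤ q z)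
    (hq_lim : ∀ z : E, z ≠ 0 →
      Tendsto (fun t : ℝ => f (t • z) / (t ^ (-d) * V t)) atTop (𝓝 (q z)))
    (hloc : ∀ z₀ : E, z₀ ≠ 0 →
      Tendsto (fun p : ℝ × E => f (p.1 • p.2) / (p.1 ^ (-d) * V p.1) - q p.2)
        (atTop ×ˢ 𝓝 z₀) (𝓝 0))
    {K : ℝ} (hK : ∀ᶠ s : ℝ in atTop, ∀ z : E, 1 ≤ ‖z‖ →
      f (s • z) / (s ^ (-d) * V s) ≤ K * ‖z‖ ^ (-(d + α / 2)))
    {ε : ℝ} (hε : 0 < ε) {δ : ℝ} (hδ : 0 < δ) :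
    ∀ᶠ s : ℝ in atTop, ∀ z : E, ε ≤ ‖z‖ → |f (s • z) / (s ^ (-d) * V s) - q z| ≤ δ := by
  have htail : Tendsto (fun r : ℝ => K * r ^ (-(d + α / 2))) atTop (𝓝 0) := by
    simpa using (tendsto_rpow_neg_atTop (by positivity : 0 < d + α / 2)).const_mul K
  obtain ⟨R, hR⟩ := eventually_atTop.1
    ((htail.eventually_le_const hδ).and (eventually_ge_atTop 1))
  have hcomp : IsCompact (Metric.closedBall (0 : E) R ∩ {z | ε ≤ ‖z‖}) :=
    (isCompact_closedBall 0 R).inter_right (isClosed_le continuous_const continuous_norm)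
  have h1 : ∀ᶠ s : ℝ in atTop, ∀ z ∈ Metric.closedBall (0 : E) R ∩ {z | ε ≤ ‖z‖},
      |f (s • z) / (s ^ (-d) * V s) - q z| ≤ δ := by
    refine eventually_forall_of_isCompact hcomp fun z hz => ?_
    have hz0 : z ≠ 0 := norm_pos_iff.1 (hε.trans_le hz.2)
    have := (hloc z hz0).abs
    rw [abs_zero] at this
    exact this.eventually_le_const hδ
  filter_upwards [h1, hK, eventually_gt_atTop 0] with s hs hs' hs0 z hz
  rcases le_total ‖z‖ R with hzR | hzR
  · exact hs z ⟨by simpa using hzR, hz⟩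
  · obtain ⟨h2, h3⟩ := hR _ hzR
    have hz0 : z ≠ 0 := norm_pos_iff.1 (hε.trans_le hz)
    have h4 : q z ≤ K * ‖z‖ ^ (-(d + α / 2)) :=
      le_of_tendsto (hq_lim z hz0) (hK.mono fun s hs => hs z h3)
    have h5 := hs' z h3
    have h6 := hq_nonneg z hz0
    have h7 : 0 < f (s • z) / (s ^ (-d) * V s) :=
      div_pos (hf_pos _) (mul_pos (Real.rpow_pos_of_pos hs0 _) (hV_pos _ hs0))
    rw [abs_le]
    constructor <;> linarith

lemma exists_forall_le_of_norm_ge (hα : 0 < α) (hd : 0 ≤ d) (hV_pos : ∀ t > 0, 0 < V t)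
    (hV_rv : ∀ x > 0, Tendsto (fun t => V (t * x) / V t) atTop (𝓝 (x ^ (-α))))
    (hq_lim : ∀ z : E, z ≠ 0 →
      Tendsto (fun t : ℝ => f (t • z) / (t ^ (-d) * V t)) atTop (𝓝 (q z)))
    {M : ℝ} (hM : ∀ z, ‖z‖ = 1 → q z ≤ M) (hM0 : 0 ≤ M) {ε : ℝ} (hε : 0 < ε) :
    ∃ B > 0, ∀ z, ε ≤ ‖z‖ → q z ≤ B := by
  refine ⟨M * ε ^ (-α) * ε ^ (-d) + 1, by positivity, fun z hz => ?_⟩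
  have hz0 : z ≠ 0 := norm_pos_iff.1 (hε.trans_le hz)
  rw [eq_radial_mul_of_tendsto hV_pos hV_rv hq_lim hz0]
  have h1 := hM _ (norm_inv_norm_smul hz0)
  have h2 : ‖z‖ ^ (-α) ≤ ε ^ (-α) := Real.rpow_le_rpow_of_nonpos hε hz (by linarith)
  have h3 : ‖z‖ ^ (-d) ≤ ε ^ (-d) := Real.rpow_le_rpow_of_nonpos hε hz (by linarith)
  calc _ ≤ M * ε ^ (-α) * ε ^ (-d) := by gcongr
    _ ≤ _ := by linarith

lemma integrableOn_norm_rpow_neg_s2 [FiniteDimensional ℝ E] [MeasurableSpace E] [BorelSpace E]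
    (μ : Measure E) [μ.IsAddHaarMeasure] {a : ℝ} (ha : (Module.finrank ℝ E : ℝ) < a) :
    IntegrableOn (fun z : E => ‖z‖ ^ (-a)) {z | 1 < ‖z‖} μ := by
  have hms : MeasurableSet {z : E | 1 < ‖z‖} :=
    (isOpen_lt continuous_const continuous_norm).measurableSet
  have ha0 : 0 < a := lt_of_le_of_lt (Nat.cast_nonneg _) ha
  refine Integrable.mono' (((integrable_one_add_norm (μ := μ) ha).const_mul
    ((2 : ℝ) ^ a)).integrableOn (s := {z : E | 1 < ‖z‖}))
    (Measurable.aestronglyMeasurable (by fun_prop)) ?_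
  filter_upwards [ae_restrict_mem hms] with z hz
  have hz1 : 1 < ‖z‖ := hz
  rw [Real.norm_of_nonneg (by positivity)]
  calc ‖z‖ ^ (-a) = 2 ^ a * (2 * ‖z‖) ^ (-a) := by
        rw [Real.mul_rpow (by norm_num) (norm_nonneg z), ← mul_assoc,
          ← Real.rpow_add (by norm_num)]
        simp
    _ ≤ 2 ^ a * (1 + ‖z‖) ^ (-a) := by
        gcongr ?_ * ?_
        exact Real.rpow_le_rpow_of_nonpos (by linarith) (by linarith) (by linarith)

open scoped Pointwise in
lemma tendsto_tail_div [FiniteDimensional ℝ E] [Nontrivial E] [MeasurableSpace E] [BorelSpace E]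
    (μ : Measure E) [μ.IsAddHaarMeasure] (hf : Continuous f) (hf_pos : ∀ z, 0 < f z) (hα : 0 < α)
    (hd : d = Module.finrank ℝ E) (hV_pos : ∀ t > 0, 0 < V t)
    (hq_lim : ∀ z : E, z ≠ 0 →
      Tendsto (fun t : ℝ => f (t • z) / (t ^ (-d) * V t)) atTop (𝓝 (q z)))
    {K : ℝ} (hK : ∀ᶠ s : ℝ in atTop, ∀ z : E, 1 ≤ ‖z‖ →
      f (s • z) / (s ^ (-d) * V s) ≤ K * ‖z‖ ^ (-(d + α / 2))) :
    Tendsto (fun s => (∫ z in {z : E | s < ‖z‖}, f z ∂μ) / V s) atTop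
      (𝓝 (∫ z in {z : E | 1 ≤ ‖z‖}, q z ∂μ)) := by
  have hms : MeasurableSet {z : E | 1 < ‖z‖} :=
    (isOpen_lt continuous_const continuous_norm).measurableSet
  have hae : {z : E | 1 ≤ ‖z‖} =ᵐ[μ] {z : E | 1 < ‖z‖} := by
    have hsph : ∀ᵐ z ∂μ, z ∉ Metric.sphere (0 : E) 1 :=
      measure_eq_zero_iff_ae_notMem.1 (Measure.addHaar_sphere μ 0 1)
    filter_upwards [hsph] with z hz
    have hz' : ‖z‖ ≠ 1 := by simpa using hz
    exact propext ⟨fun h => lt_of_le_of_ne h hz'.symm, le_of_lt⟩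
  rw [setIntegral_congr_set hae]
  have hlim : Tendsto (fun s : ℝ => ∫ z in {z : E | 1 < ‖z‖}, f (s • z) / (s ^ (-d) * V s) ∂μ)
      atTop (𝓝 (∫ z in {z : E | 1 < ‖z‖}, q z ∂μ)) := by
    refine tendsto_integral_filter_of_dominated_convergence
      (fun z => K * ‖z‖ ^ (-(d + α / 2))) ?_ ?_ ?_ ?_
    · exact Eventually.of_forall fun s => Continuous.aestronglyMeasurable (by fun_prop)
    · filter_upwards [hK, eventually_gt_atTop 0] with s hs hs0
      filter_upwards [ae_restrict_mem hms] with z hz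
      have := hV_pos s hs0
      have := hf_pos (s • z)
      rw [Real.norm_of_nonneg (by positivity)]
      exact hs z (le_of_lt hz)
    · exact (integrableOn_norm_rpow_neg_s2 μ (by rw [hd]; linarith)).const_mul K
    · filter_upwards [ae_restrict_mem hms] with z hz
      exact hq_lim z (norm_pos_iff.1 (one_pos.trans hz))
  refine hlim.congr' ?_
  filter_upwards [eventually_gt_atTop 0] with s hs
  have hset : s • {z : E | 1 < ‖z‖} = {z : E | s < ‖z‖} := by
    ext z
    rw [Set.mem_smul_set_iff_inv_smul_mem₀ hs.ne']
    simp only [Set.mem_ofPred_eq, norm_smul, norm_inv, Real.norm_of_nonneg hs.le]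
    rw [inv_mul_eq_div, one_lt_div hs]
  have hpow : 0 < s ^ Module.finrank ℝ E := pow_pos hs _
  rw [integral_div, Measure.setIntegral_comp_smul_of_pos μ f _ hs, hset, hd, Real.rpow_neg hs.le,
    Real.rpow_natCast, smul_eq_mul]
  field_simp

lemma measure_norm_gt_pos [FiniteDimensional ℝ E] [Nontrivial E] [MeasurableSpace E] [BorelSpace E]
    (μ : Measure E) [μ.IsAddHaarMeasure] (hf : Continuous f) (hf_pos : ∀ z, 0 < f z) (s : ℝ) :
    0 < μ.withDensity (fun z => ENNReal.ofReal (f z)) {z : E | s < ‖z‖} := by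
  have ho : IsOpen {z : E | s < ‖z‖} := isOpen_lt continuous_const continuous_norm
  obtain ⟨z, hz⟩ := NormedSpace.exists_lt_norm ℝ E s
  have hpos : 0 < μ {z : E | s < ‖z‖} := ho.measure_pos μ ⟨z, hz⟩
  refine pos_iff_ne_zero.2 fun h => hpos.ne' ?_
  rw [withDensity_apply_eq_zero' (by fun_prop)] at h
  refine measure_mono_null (fun z hz => Set.mem_inter ?_ hz) h
  simpa using hf_pos z

end Density

section Quantile

variable {E : Type*} [NormedAddCommGroup E] [MeasurableSpace E] [OpensMeasurableSpace E]
  {P : Measure E} [IsProbabilityMeasure P] {U : ℝ → ℝ}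

lemma measureReal_quantile_lt_norm
    (hU : ∀ t > (1 : ℝ), P {z | ‖z‖ ≤ U t} = ENNReal.ofReal (1 - 1 / t)) {t : ℝ} (ht : 1 < t) :
    P.real {z | U t < ‖z‖} = 1 / t := by
  have hms : MeasurableSet {z : E | ‖z‖ ≤ U t} :=
    (isClosed_le continuous_norm continuous_const).measurableSet
  have hcompl : {z : E | U t < ‖z‖} = {z : E | ‖z‖ ≤ U t}ᶜ := by
    ext z
    simp
  have h1 : 1 / t ≤ 1 := by
    rw [div_le_one (by linarith)]
    exact ht.le
  rw [hcompl, probReal_compl_eq_one_sub hms, measureReal_def, hU t ht,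
    ENNReal.toReal_ofReal (by linarith)]
  ring

lemma tendsto_quantile_atTop
    (hU : ∀ t > (1 : ℝ), P {z | ‖z‖ ≤ U t} = ENNReal.ofReal (1 - 1 / t))
    (hP : ∀ s : ℝ, 0 < P {z | s < ‖z‖}) : Tendsto U atTop atTop := by
  refine tendsto_atTop.2 fun s => ?_
  have hp : 0 < P.real {z | s < ‖z‖} := ENNReal.toReal_pos (hP s).ne' (measure_ne_top _ _)
  have hlim : Tendsto (fun t : ℝ => 1 / t) atTop (𝓝 0) := by
    simpa using tendsto_inv_atTop_zero (𝕜 := ℝ)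
  filter_upwards [hlim.eventually_lt_const hp, eventually_gt_atTop 1] with t ht ht1
  by_contra! hlt
  refine ht.not_ge ?_
  rw [← measureReal_quantile_lt_norm hU ht1]
  exact measureReal_mono fun z hz => hlt.trans hz

end Quantile

/-- With `l = 1/∫_{‖z‖≥1} q(z) dz ∈ (0,∞)` and
`q_t(z) = t (U(t))^d f(U(t) z)`, for every `ε > 0`,
`lim_{t→∞} sup_{‖z‖ ≥ ε} |q_t(z) − l q(z)| = 0`. -/
theorem extreme_risk_qt_uniform_convergence
    (d : ℕ) (hd : 2 ≤ d)
    (P : Measure (EuclideanSpace ℝ (Fin d))) [IsProbabilityMeasure P]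
    (f : EuclideanSpace ℝ (Fin d) → ℝ)
    (hf_cont : Continuous f) (hf_pos : ∀ z, 0 < f z)
    (hP : P = volume.withDensity (fun z => ENNReal.ofReal (f z)))
    (α : ℝ) (hα : 0 < α)
    (V : ℝ → ℝ) (hV_pos : ∀ t > (0 : ℝ), 0 < V t)
    (hV_rv : ∀ x > (0 : ℝ),
      Tendsto (fun t => V (t * x) / V t) atTop (𝓝 (x ^ (-α))))
    (q : EuclideanSpace ℝ (Fin d) → ℝ)
    (hq_nonneg : ∀ z : EuclideanSpace ℝ (Fin d), z ≠ 0 → 0 ≤ q z)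
    (hq_lim : ∀ z : EuclideanSpace ℝ (Fin d), z ≠ 0 →
      Tendsto (fun t : ℝ => f (t • z) / (t ^ (-(d : ℝ)) * V t)) atTop (𝓝 (q z)))
    (hq_unif : ∀ δ > (0 : ℝ), ∃ t₀ > (0 : ℝ), ∀ t ≥ t₀,
      ∀ z : EuclideanSpace ℝ (Fin d), ‖z‖ = 1 →
        |f (t • z) / (t ^ (-(d : ℝ)) * V t) - q z| ≤ δ)
    -- the quantile function U(t) = H⁻¹(1 − 1/t) of the radius R = ‖X‖
    (U : ℝ → ℝ)
    (hU : ∀ t > (1 : ℝ), P {z | ‖z‖ ≤ U t} = ENNReal.ofReal (1 - 1 / t))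
    -- l = 1/∫_{‖z‖ ≥ 1} q(z) dz, with the integral in (0,∞)
    (hq_int : IntegrableOn q {z : EuclideanSpace ℝ (Fin d) | 1 ≤ ‖z‖} volume)
    (hq_int_pos : 0 < ∫ z in {z : EuclideanSpace ℝ (Fin d) | 1 ≤ ‖z‖}, q z)
    (l : ℝ) (hl : l = (∫ z in {z : EuclideanSpace ℝ (Fin d) | 1 ≤ ‖z‖}, q z)⁻¹) :
    ∀ ε > (0 : ℝ), ∀ δ > (0 : ℝ), ∃ t₀ > (1 : ℝ), ∀ t ≥ t₀,
      ∀ z : EuclideanSpace ℝ (Fin d), ε ≤ ‖z‖ →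
        |t * (U t) ^ d * f (U t • z) - l * q z| ≤ δ := by
  have hdim : Module.finrank ℝ (EuclideanSpace ℝ (Fin d)) = d := by simp
  have : Nontrivial (EuclideanSpace ℝ (Fin d)) :=
    Module.nontrivial_of_finrank_pos (R := ℝ) (by omega)
  have hd0 : (0 : ℝ) ≤ d := Nat.cast_nonneg d
  obtain ⟨w, hw0, hqw⟩ : ∃ w, w ≠ 0 ∧ 0 < q w := by
    by_contra! h
    refine hq_int_pos.ne' (setIntegral_eq_zero_of_forall_eq_zero fun z hz => ?_)
    have hz0 : z ≠ 0 := norm_pos_iff.1 (one_pos.trans_le hz)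
    exact le_antisymm (h z hz0) (hq_nonneg z hz0)
  have hW_cont : Continuous fun t : ℝ => f (t • w) * t ^ d := by fun_prop
  have hW_pos : ∀ t > (0 : ℝ), 0 < f (t • w) * t ^ d := fun t ht =>
    mul_pos (hf_pos _) (pow_pos ht d)
  have hWV : Tendsto (fun t : ℝ => f (t • w) * t ^ d / V t) atTop (𝓝 (q w)) := by
    refine (hq_lim w hw0).congr' ?_
    filter_upwards [eventually_gt_atTop 0] with t ht
    have := pow_pos ht d
    rw [Real.rpow_neg ht.le, Real.rpow_natCast]
    field_simp
  obtain ⟨C, -, hC⟩ :=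
    exists_div_le_rpow_of_regularlyVarying hα hV_pos hV_rv hW_cont hW_pos hqw hWV
  obtain ⟨M, hM0, hM⟩ : ∃ M : ℝ, 0 ≤ M ∧ ∀ z, ‖z‖ = 1 → q z ≤ M := by
    obtain ⟨M, hM⟩ := (isCompact_sphere _ _).exists_bound_of_continuousOn
      (continuousOn_sphere_of_unif hf_cont hq_unif)
    refine ⟨max M 0, le_max_right _ _, fun z hz => ?_⟩
    exact ((le_abs_self _).trans (hM z (by simpa using hz))).trans (le_max_left _ _)
  have hK := exists_density_le_rpow hV_pos hC hM hM0 hq_unif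
  have hloc := fun z₀ hz₀ => tendsto_density_sub_of_unif (z₀ := z₀) hf_cont hV_pos hV_rv
    (fun r hr => tendsto_div_of_regularlyVarying hV_pos hV_rv hW_cont hW_pos hqw hWV hr)
    hq_lim hq_unif hz₀
  have hU_lim : Tendsto U atTop atTop := by
    refine tendsto_quantile_atTop hU fun s => ?_
    rw [hP]
    exact measure_norm_gt_pos volume hf_cont hf_pos s
  have htail : ∀ s, P.real {z | s < ‖z‖} = ∫ z in {z | s < ‖z‖}, f z := fun s => by
    rw [integral_eq_lintegral_of_nonneg_ae (ae_of_all _ fun z => (hf_pos z).le)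
      hf_cont.aestronglyMeasurable, measureReal_def, hP, withDensity_apply _
      (isOpen_lt continuous_const continuous_norm).measurableSet]
  have htV : Tendsto (fun t => t * V (U t)) atTop (𝓝 l) := by
    have h1 := ((tendsto_tail_div volume hf_cont hf_pos hα (by rw [hdim]) hV_pos hq_lim
      hK).comp hU_lim).inv₀ hq_int_pos.ne'
    rw [← hl] at h1
    refine h1.congr' ?_
    filter_upwards [eventually_gt_atTop 1] with t ht
    rw [Function.comp_apply, ← htail, measureReal_quantile_lt_norm hU ht]
    field_simp
  intro ε hε δ hδ
  have hl_pos : 0 < l := hl ▸ inv_pos.2 hq_int_pos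
  obtain ⟨B, hB0, hB⟩ := exists_forall_le_of_norm_ge hα hd0 hV_pos hV_rv hq_lim hM hM0 hε
  have hunif := hU_lim.eventually (eventually_forall_abs_sub_le hf_pos hα hd0 hV_pos hq_nonneg
    hq_lim hloc hK hε (by positivity : 0 < δ / (2 * (l + 1))))
  have hclose := Metric.tendsto_nhds.1 htV (min 1 (δ / (2 * B))) (by positivity)
  obtain ⟨t₀, ht₀⟩ := eventually_atTop.1
    ((hunif.and hclose).and (hU_lim.eventually_gt_atTop 0))
  refine ⟨max t₀ 2, lt_max_of_lt_right one_lt_two, fun t ht z hz => ?_⟩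
  obtain ⟨⟨h1, h2⟩, hUt⟩ := ht₀ t (le_of_max_le_left ht)
  replace h1 := h1 z hz
  rw [Real.dist_eq] at h2
  have hqB := hB z hz
  have hq0 := hq_nonneg z (norm_pos_iff.1 (hε.trans_le hz))
  have hVU := hV_pos _ hUt
  have htV0 : 0 ≤ t * V (U t) := mul_nonneg (by linarith [le_of_max_le_right ht]) hVU.le
  have htV1 : t * V (U t) ≤ l + 1 := by
    linarith [(abs_lt.1 (h2.trans_le (min_le_left _ _))).2]
  set F := f (U t • z) / (U t ^ (-(d : ℝ)) * V (U t)) with hF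
  have heq : t * U t ^ d * f (U t • z) - l * q z =
      t * V (U t) * (F - q z) + (t * V (U t) - l) * q z := by
    have := pow_pos hUt d
    rw [hF, Real.rpow_neg hUt.le, Real.rpow_natCast]
    field_simp
    ring
  rw [heq]
  calc _ ≤ |t * V (U t)| * |F - q z| + |t * V (U t) - l| * |q z| := by
        rw [← abs_mul, ← abs_mul]
        exact abs_add_le _ _
    _ ≤ (l + 1) * (δ / (2 * (l + 1))) + δ / (2 * B) * B := by
        rw [abs_of_nonneg htV0, abs_of_nonneg hq0]
        gcongr
        exact h2.le.trans (min_le_right _ _)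
    _ = δ := by
        field_simp
        norm_num
end

section
/- For every Borel set B ⊂ ℝ^d with positive distance from the origin, lim_{t→∞} t · P(X ∈ U(t)·B) = ν(B), where U(t)·B = {U(t)z : z ∈ B}. -/
open MeasureTheory Filter Topology Pointwise

/-- A nonnegative limit of functions whose integrals over `A` converge to `c` is integrable
over `A`, with integral at most `c`. -/
theorem integrableOn_and_setIntegral_le_of_tendsto {E : Type*} [MeasurableSpace E]
    {μ : Measure E} {A : Set E} (hA : MeasurableSet A) {g : ℕ → E → ℝ} {q : E → ℝ} {c : ℝ}
    (hg : ∀ᶠ n in atTop, ∀ z ∈ A, 0 ≤ g n z)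
    (hgi : ∀ n, IntegrableOn (g n) A μ)
    (hq : ∀ z ∈ A, 0 ≤ q z)
    (hlim : ∀ z ∈ A, Tendsto (fun n => g n z) atTop (𝓝 (q z)))
    (hc : Tendsto (fun n => ∫ z in A, g n z ∂μ) atTop (𝓝 c)) :
    IntegrableOn q A μ ∧ ∫ z in A, q z ∂μ ≤ c := by
  have hlim' : ∀ᵐ z ∂μ.restrict A, Tendsto (fun n => g n z) atTop (𝓝 (q z)) :=
    (ae_restrict_iff' hA).2 (.of_forall hlim)
  have hq' : 0 ≤ᵐ[μ.restrict A] q := (ae_restrict_iff' hA).2 (.of_forall hq)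
  have hqm : AEStronglyMeasurable q (μ.restrict A) :=
    aestronglyMeasurable_of_tendsto_ae atTop (fun n => (hgi n).aestronglyMeasurable) hlim'
  have hc0 : 0 ≤ c := ge_of_tendsto hc <| by
    filter_upwards [hg] with n hn using setIntegral_nonneg hA hn
  have key : ∫⁻ z in A, ENNReal.ofReal (q z) ∂μ ≤ ENNReal.ofReal c := by
    calc ∫⁻ z in A, ENNReal.ofReal (q z) ∂μ
        = ∫⁻ z in A, liminf (fun n => ENNReal.ofReal (g n z)) atTop ∂μ := by
          refine lintegral_congr_ae ?_
          filter_upwards [hlim'] with z hz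
          exact ((ENNReal.tendsto_ofReal hz).liminf_eq).symm
      _ ≤ liminf (fun n => ∫⁻ z in A, ENNReal.ofReal (g n z) ∂μ) atTop :=
          lintegral_liminf_le' fun n => (hgi n).aemeasurable.ennreal_ofReal
      _ = ENNReal.ofReal c := by
          refine Tendsto.liminf_eq ((ENNReal.tendsto_ofReal hc).congr' ?_)
          filter_upwards [hg] with n hn
          exact ofReal_integral_eq_lintegral_ofReal (hgi n)
            ((ae_restrict_iff' hA).2 (.of_forall hn))
  refine ⟨⟨hqm, ?_⟩, ?_⟩
  · rw [hasFiniteIntegral_iff_ofReal hq']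
    exact key.trans_lt ENNReal.ofReal_lt_top
  · rw [integral_eq_lintegral_of_nonneg_ae hq' hqm]
    exact ENNReal.toReal_le_of_le_ofReal hc0 key

/-- Convergence of integrals over sets bounded away from the origin, for nonnegative functions
that are locally uniformly bounded there and whose tail integrals are asymptotically small. -/
theorem tendsto_setIntegral_of_tendsto_tail {E : Type*} [NormedAddCommGroup E] [ProperSpace E]
    [MeasurableSpace E] [BorelSpace E] {μ : Measure E} [IsFiniteMeasureOnCompacts μ]
    {g : ℝ → E → ℝ} {q : E → ℝ} {w : ℝ → ℝ}
    (hg : ∀ s > 0, ∀ z, 0 ≤ g s z) (hgi : ∀ s, Integrable (g s) μ)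
    (hq : ∀ z, z ≠ 0 → 0 ≤ q z)
    (hlim : ∀ z, z ≠ 0 → Tendsto (fun s => g s z) atTop (𝓝 (q z)))
    (hbound : ∀ r > 0, ∃ C, ∀ᶠ s in atTop, ∀ z, r ≤ ‖z‖ → g s z ≤ C)
    (htail : ∀ R > 0, Tendsto (fun s => ∫ z in {z | R < ‖z‖}, g s z ∂μ) atTop (𝓝 (w R)))
    (hw : Tendsto w atTop (𝓝 0))
    {B : Set E} (hB : MeasurableSet B) {r : ℝ} (hr : 0 < r) (hBr : ∀ z ∈ B, r ≤ ‖z‖) :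
    Tendsto (fun s => ∫ z in B, g s z ∂μ) atTop (𝓝 (∫ z in B, q z ∂μ)) := by
  have hT : ∀ R : ℝ, MeasurableSet {z : E | R < ‖z‖} := fun R =>
    measurableSet_lt measurable_const measurable_norm
  have hne : ∀ {R : ℝ}, 0 < R → ∀ z ∈ {z : E | R < ‖z‖}, z ≠ 0 := fun hR z hz =>
    norm_pos_iff.1 (hR.trans hz)
  have hqtail : ∀ R > 0, IntegrableOn q {z | R < ‖z‖} μ ∧ ∫ z in {z | R < ‖z‖}, q z ∂μ ≤ w R := by
    intro R hR
    refine integrableOn_and_setIntegral_le_of_tendsto (g := fun n : ℕ => g n) (hT R) ?_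
      (fun n => (hgi n).integrableOn) (fun z hz => hq z (hne hR z hz))
      (fun z hz => (hlim z (hne hR z hz)).comp tendsto_natCast_atTop_atTop)
      ((htail R hR).comp tendsto_natCast_atTop_atTop)
    filter_upwards [eventually_gt_atTop 0] with n hn z _ using hg n (by exact_mod_cast hn) z
  have hqB : IntegrableOn q B μ := (hqtail (r / 2) (by positivity)).1.mono_set
    fun z hz => (half_lt_self hr).trans_le (hBr z hz)
  have htrunc : ∀ R > 0, Tendsto (fun s => ∫ z in B \ {z | R < ‖z‖}, g s z ∂μ) atTop
      (𝓝 (∫ z in B \ {z | R < ‖z‖}, q z ∂μ)) := by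
    intro R hR
    have hfin : μ (B \ {z | R < ‖z‖}) < ⊤ :=
      (measure_mono fun z hz => by simpa using hz.2).trans_lt
        (measure_closedBall_lt_top (x := (0 : E)) (r := R))
    have hmeas := hB.diff (hT R)
    obtain ⟨C, hC⟩ := hbound r hr
    refine tendsto_integral_filter_of_dominated_convergence (fun _ => C) ?_ ?_ ?_ ?_
    · exact .of_forall fun s => (hgi s).integrableOn.aestronglyMeasurable
    · filter_upwards [hC, eventually_gt_atTop 0] with s hs hs0
      refine (ae_restrict_iff' hmeas).2 (.of_forall fun z hz => ?_)
      rw [Real.norm_of_nonneg (hg s hs0 z)]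
      exact hs z (hBr z hz.1)
    · exact integrableOn_const hfin.ne
    · exact (ae_restrict_iff' hmeas).2 (.of_forall fun z hz =>
        hlim z (norm_pos_iff.1 (hr.trans_le (hBr z hz.1))))
  rw [Metric.tendsto_atTop']
  intro ε hε
  obtain ⟨R, hwR, hR⟩ := ((hw.eventually (gt_mem_nhds (show 0 < ε / 3 by positivity))).and
    (eventually_gt_atTop 0)).exists
  have hev := (((htail R hR).eventually (gt_mem_nhds hwR)).and
    ((Metric.tendsto_nhds.1 (htrunc R hR)) (ε / 3) (by positivity))).and (eventually_gt_atTop 0)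
  obtain ⟨N, hN⟩ := eventually_atTop.1 hev
  refine ⟨N, fun s hs => ?_⟩
  obtain ⟨⟨h1, h2⟩, hs0⟩ := hN s hs.le
  have hsplitg := integral_inter_add_sdiff (hT R) ((hgi s).integrableOn (s := B))
  have hsplitq := integral_inter_add_sdiff (hT R) hqB
  have hg1 : ∫ z in B ∩ {z | R < ‖z‖}, g s z ∂μ ≤ ∫ z in {z | R < ‖z‖}, g s z ∂μ :=
    setIntegral_mono_set (hgi s).integrableOn (.of_forall (hg s hs0))
      (.of_forall fun z hz => hz.2)
  have hg0 : 0 ≤ ∫ z in B ∩ {z | R < ‖z‖}, g s z ∂μ :=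
    setIntegral_nonneg (hB.inter (hT R)) fun z _ => hg s hs0 z
  have hq1 : ∫ z in B ∩ {z | R < ‖z‖}, q z ∂μ ≤ ∫ z in {z | R < ‖z‖}, q z ∂μ :=
    setIntegral_mono_set (hqtail R hR).1
      ((ae_restrict_iff' (hT R)).2 (.of_forall fun z hz => hq z (hne hR z hz)))
      (.of_forall fun z hz => hz.2)
  have hq0 : 0 ≤ ∫ z in B ∩ {z | R < ‖z‖}, q z ∂μ :=
    setIntegral_nonneg (hB.inter (hT R)) fun z hz => hq z (hne hR z hz.2)
  have hq2 := (hqtail R hR).2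
  rw [Real.dist_eq, abs_lt] at h2 ⊢
  constructor <;> linarith [h2.1, h2.2]

/-- The measure of a dilated set under a law with density, after the change of variables. -/
theorem toReal_withDensity_smul_eq {d : ℕ} {f : EuclideanSpace ℝ (Fin d) → ℝ}
    (hf : Measurable f) (hf0 : ∀ z, 0 ≤ f z) {s : ℝ} (hs : 0 < s)
    {B : Set (EuclideanSpace ℝ (Fin d))} (hB : MeasurableSet B) :
    (volume.withDensity (fun z => ENNReal.ofReal (f z)) (s • B)).toReal
      = s ^ d * ∫ z in B, f (s • z) := by
  rw [withDensity_apply _ (hB.const_smul₀ s), Measure.setIntegral_comp_smul _ _ _ hs.ne',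
    integral_eq_lintegral_of_nonneg_ae (.of_forall hf0) hf.aestronglyMeasurable]
  simp only [finrank_euclideanSpace, Fintype.card_fin, smul_eq_mul]
  rw [abs_of_pos (by positivity), mul_inv_cancel_left₀ (by positivity)]

/-- An antitone nonnegative function that is regularly varying never vanishes. -/
theorem pos_of_antitone_of_tendsto_ratio {V : ℝ → ℝ} (hV : Antitone V) (hV0 : ∀ s, 0 ≤ V s)
    (h : Tendsto (fun t => V t / V t) atTop (𝓝 1)) (s : ℝ) : 0 < V s := by
  refine (hV0 s).lt_of_ne' fun hs => ?_
  refine zero_ne_one (tendsto_nhds_unique (h.congr' ?_) tendsto_const_nhds).symm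
  filter_upwards [eventually_ge_atTop s] with t ht
  rw [le_antisymm (hs ▸ hV ht) (hV0 t), div_zero]

/-- Normalised densities are eventually uniformly bounded away from the origin. -/
theorem exists_eventually_normalized_density_le {d : ℕ} {f : EuclideanSpace ℝ (Fin d) → ℝ}
    (hf : Continuous f) (hf0 : ∀ z, 0 ≤ f z) {V : ℝ → ℝ} (hV : Antitone V) (hVpos : ∀ s, 0 < V s)
    {α : ℝ} (hV_rv : ∀ x > (0 : ℝ), Tendsto (fun t => V (t * x) / V t) atTop (𝓝 (x ^ (-α))))
    {q : EuclideanSpace ℝ (Fin d) → ℝ}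
    (hq_unif : ∀ δ > (0 : ℝ), ∃ t₀ > (0 : ℝ), ∀ t ≥ t₀,
      ∀ z : EuclideanSpace ℝ (Fin d), ‖z‖ = 1 →
        |f (t • z) / (t ^ (-(d : ℝ)) * V t) - q z| ≤ δ) {r : ℝ} (hr : 0 < r) :
    ∃ C, ∀ᶠ s in atTop, ∀ z : EuclideanSpace ℝ (Fin d), r ≤ ‖z‖ →
      f (s • z) / (s ^ (-(d : ℝ)) * V s) ≤ C := by
  obtain ⟨t₀, ht₀, h⟩ := hq_unif 1 one_pos
  obtain ⟨M, hM⟩ := (isCompact_sphere (0 : EuclideanSpace ℝ (Fin d)) 1).bddAbove_image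
    (f := fun z => f (t₀ • z) / (t₀ ^ (-(d : ℝ)) * V t₀)) (by fun_prop)
  have hdir : ∀ t ≥ t₀, ∀ z : EuclideanSpace ℝ (Fin d), ‖z‖ = 1 →
      f (t • z) / (t ^ (-(d : ℝ)) * V t) ≤ M + 2 := by
    intro t ht z hz
    have h1 := (abs_le.1 (h t ht z hz)).2
    have h2 := (abs_le.1 (h t₀ le_rfl z hz)).1
    have h3 := hM (Set.mem_image_of_mem _ (mem_sphere_zero_iff_norm.2 hz))
    linarith
  refine ⟨r ^ (-(d : ℝ)) * (r ^ (-α) + 1) * (M + 2), ?_⟩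
  filter_upwards [(hV_rv r hr).eventually (gt_mem_nhds (lt_add_one _)),
    eventually_ge_atTop (t₀ / r), eventually_gt_atTop 0] with s hs1 hs2 hs0 z hz
  have hz0 : 0 < ‖z‖ := hr.trans_le hz
  have hst : t₀ ≤ s * ‖z‖ :=
    ((div_le_iff₀ hr).1 hs2).trans (mul_le_mul_of_nonneg_left hz hs0.le)
  have hu : ‖‖z‖⁻¹ • z‖ = 1 := by
    rw [norm_smul, norm_inv, norm_norm, inv_mul_cancel₀ hz0.ne']
  have hd1 := hdir _ hst _ hu
  have hfac : f (s • z) / (s ^ (-(d : ℝ)) * V s)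
      = ‖z‖ ^ (-(d : ℝ)) * (V (s * ‖z‖) / V s) *
        (f ((s * ‖z‖) • ‖z‖⁻¹ • z) / ((s * ‖z‖) ^ (-(d : ℝ)) * V (s * ‖z‖))) := by
    rw [smul_smul, mul_assoc s, mul_inv_cancel₀ hz0.ne', mul_one, Real.mul_rpow hs0.le hz0.le]
    have := (hVpos s).ne'
    have := (hVpos (s * ‖z‖)).ne'
    have := (Real.rpow_pos_of_pos hs0 (-(d : ℝ))).ne'
    have := (Real.rpow_pos_of_pos hz0 (-(d : ℝ))).ne'
    field_simp
  rw [hfac]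
  have hnn : 0 ≤ f ((s * ‖z‖) • ‖z‖⁻¹ • z) / ((s * ‖z‖) ^ (-(d : ℝ)) * V (s * ‖z‖)) :=
    div_nonneg (hf0 _) (mul_nonneg (by positivity) (hVpos _).le)
  have hV1 : V (s * ‖z‖) / V s ≤ r ^ (-α) + 1 :=
    (div_le_div_of_nonneg_right (hV (mul_le_mul_of_nonneg_left hz hs0.le)) (hVpos s).le).trans
      hs1.le
  have hp : ‖z‖ ^ (-(d : ℝ)) ≤ r ^ (-(d : ℝ)) :=
    Real.rpow_le_rpow_of_nonpos hr hz (by simp)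
  have hVn : 0 ≤ V (s * ‖z‖) / V s := div_nonneg (hVpos _).le (hVpos s).le
  gcongr

/-- If `V (U t) = 1 / t` eventually, with `V` antitone and positive, then `U t → ∞`. -/
theorem tendsto_atTop_of_antitone_of_eq_inv {V U : ℝ → ℝ} (hV : Antitone V)
    (hVpos : ∀ s, 0 < V s) (h : ∀ᶠ t in atTop, V (U t) = 1 / t) : Tendsto U atTop atTop := by
  refine tendsto_atTop.2 fun M => ?_
  filter_upwards [h, eventually_gt_atTop (1 / V M), eventually_gt_atTop 0] with t ht h1 h0
  by_contra hlt
  have h2 := hV (not_le.1 hlt).le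
  rw [ht, le_div_iff₀ h0] at h2
  rw [div_lt_iff₀ (hVpos M)] at h1
  linarith

/-- With `V = 1 − H` and `U(t) = H⁻¹(1 − 1/t)`, for every Borel set
`B` with positive distance from the origin, `lim_{t→∞} t P(X ∈ U(t)B) = ν(B)`,
where `ν(B) = ∫_B q(z) dz`. -/
theorem extreme_risk_U_scaling_convergence
    (d : ℕ) (hd : 2 ≤ d)
    (P : Measure (EuclideanSpace ℝ (Fin d))) [IsProbabilityMeasure P]
    (f : EuclideanSpace ℝ (Fin d) → ℝ)
    (hf_cont : Continuous f) (hf_pos : ∀ z, 0 < f z)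
    (hP : P = volume.withDensity (fun z => ENNReal.ofReal (f z)))
    (α : ℝ) (hα : 0 < α)
    -- V = 1 − H, i.e. V(t) = P(‖X‖ > t), regularly varying with index −α
    (V : ℝ → ℝ)
    (hV_def : ∀ t : ℝ, V t = (P {z | t < ‖z‖}).toReal)
    (hV_rv : ∀ x > (0 : ℝ),
      Tendsto (fun t => V (t * x) / V t) atTop (𝓝 (x ^ (-α))))
    (q : EuclideanSpace ℝ (Fin d) → ℝ)
    (hq_nonneg : ∀ z : EuclideanSpace ℝ (Fin d), z ≠ 0 → 0 ≤ q z)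
    (hq_lim : ∀ z : EuclideanSpace ℝ (Fin d), z ≠ 0 →
      Tendsto (fun t : ℝ => f (t • z) / (t ^ (-(d : ℝ)) * V t)) atTop (𝓝 (q z)))
    (hq_unif : ∀ δ > (0 : ℝ), ∃ t₀ > (0 : ℝ), ∀ t ≥ t₀,
      ∀ z : EuclideanSpace ℝ (Fin d), ‖z‖ = 1 →
        |f (t • z) / (t ^ (-(d : ℝ)) * V t) - q z| ≤ δ)
    -- the quantile function U(t) = H⁻¹(1 − 1/t)
    (U : ℝ → ℝ)
    (hU : ∀ t > (1 : ℝ), P {z | ‖z‖ ≤ U t} = ENNReal.ofReal (1 - 1 / t))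
    (B : Set (EuclideanSpace ℝ (Fin d))) (hB_meas : MeasurableSet B)
    (hB_away : ∃ r > (0 : ℝ), ∀ z ∈ B, r ≤ ‖z‖) :
    Tendsto (fun t : ℝ => t * (P (U t • B)).toReal) atTop (𝓝 (∫ z in B, q z)) := by
  subst hP
  set P := (volume : Measure (EuclideanSpace ℝ (Fin d))).withDensity
    (fun z => ENNReal.ofReal (f z)) with hPdef
  have hf0 : ∀ z, 0 ≤ f z := fun z => (hf_pos z).le
  have hV : Antitone V := fun a b hab => by
    rw [hV_def, hV_def]
    exact ENNReal.toReal_mono (measure_ne_top _ _) (measure_mono fun z hz => hab.trans_lt hz)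
  have hVpos : ∀ s, 0 < V s := pos_of_antitone_of_tendsto_ratio hV
    (fun s => by rw [hV_def]; exact ENNReal.toReal_nonneg)
    (by simpa using hV_rv 1 one_pos)
  have hfint : Integrable f := by
    refine ⟨hf_cont.aestronglyMeasurable, ?_⟩
    rw [hasFiniteIntegral_iff_ofReal (.of_forall hf0), ← setLIntegral_univ,
      ← withDensity_apply _ MeasurableSet.univ]
    exact measure_lt_top P _
  have hT : ∀ R : ℝ, MeasurableSet {z : EuclideanSpace ℝ (Fin d) | R < ‖z‖} := fun R =>
    measurableSet_lt measurable_const measurable_norm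
  have hratio : ∀ s > 0, ∀ A : Set (EuclideanSpace ℝ (Fin d)), MeasurableSet A →
      ∫ z in A, f (s • z) / (s ^ (-(d : ℝ)) * V s) = (P (s • A)).toReal / V s := by
    intro s hs A hA
    rw [hPdef, toReal_withDensity_smul_eq hf_cont.measurable hf0 hs hA, integral_div,
      Real.rpow_neg hs.le, Real.rpow_natCast]
    have := (hVpos s).ne'
    field_simp
  have hmain : Tendsto (fun s => ∫ z in B, f (s • z) / (s ^ (-(d : ℝ)) * V s)) atTop
      (𝓝 (∫ z in B, q z)) := by
    obtain ⟨r, hr, hBr⟩ := hB_away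
    refine tendsto_setIntegral_of_tendsto_tail (w := fun R => R ^ (-α)) ?_ ?_ hq_nonneg hq_lim
      (fun r hr => exists_eventually_normalized_density_le hf_cont hf0 hV hVpos hV_rv hq_unif hr)
      ?_ (tendsto_rpow_neg_atTop hα) hB_meas hr hBr
    · exact fun s hs z => div_nonneg (hf0 _) (mul_nonneg (by positivity) (hVpos s).le)
    · intro s
      rcases eq_or_ne s 0 with rfl | hs
      · have : (0 : ℝ) ^ (-(d : ℝ)) = 0 := Real.zero_rpow (by simp; omega)
        simp [this]
      · exact (hfint.comp_smul hs).div_const _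
    · intro R hR
      refine (hV_rv R hR).congr' ?_
      filter_upwards [eventually_gt_atTop 0] with s hs
      rw [hratio s hs _ (hT R), hV_def (s * R)]
      congr 3
      ext z
      rw [Set.mem_smul_set_iff_inv_smul_mem₀ hs.ne']
      simp only [Set.mem_ofPred_eq, norm_smul, norm_inv, Real.norm_of_nonneg hs.le]
      rw [inv_mul_eq_div, lt_div_iff₀ hs, mul_comm]
  have hVU : ∀ t > (1 : ℝ), V (U t) = 1 / t := by
    intro t ht
    have hcompl : {z : EuclideanSpace ℝ (Fin d) | U t < ‖z‖} = {z | ‖z‖ ≤ U t}ᶜ := by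
      ext z; simp
    have h1 : 1 / t ≤ 1 := (div_le_one (by linarith)).2 ht.le
    rw [hV_def, hcompl, prob_compl_eq_one_sub (measurableSet_le measurable_norm measurable_const),
      hU t ht, ENNReal.toReal_sub_of_le (by rw [ENNReal.ofReal_le_one]; simp; linarith)
      ENNReal.one_ne_top, ENNReal.toReal_ofReal (by linarith), ENNReal.toReal_one]
    ring
  have hUtop : Tendsto U atTop atTop := tendsto_atTop_of_antitone_of_eq_inv hV hVpos <| by
    filter_upwards [eventually_gt_atTop 1] with t ht using hVU t ht
  refine (hmain.comp hUtop).congr' ?_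
  filter_upwards [hUtop.eventually_gt_atTop 0, eventually_gt_atTop 1] with t hUt ht
  rw [Function.comp_apply, hratio _ hUt B hB_meas, hVU t ht]
  field_simp
end

section
/- Assume in addition that q is strictly positive on the unit sphere Θ. Then for every ε > 0 there exist δ > 0 and t₀ > 0 such that for all t > t₀, { z ∈ ℝ^d : f(tz)/(t^{−d}V(t)) ≤ ε } ⊂ { z ∈ ℝ^d : ‖z‖ > δ }. -/
open MeasureTheory Filter Topology

/-- A positive continuous regularly varying function has locally bounded ratios on some
multiplicative interval (Baire category). -/
theorem exists_Icc_ratio_le_of_tendsto_ratio {g : ℝ → ℝ} (hg : Continuous g)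
    (hpos : ∀ t, 0 < g t) {l : ℝ → ℝ}
    (hrv : ∀ x > (0 : ℝ), Tendsto (fun t => g (t * x) / g t) atTop (𝓝 (l x))) :
    ∃ p q : ℝ, p < q ∧ ∃ C > (0 : ℝ), ∀ y ∈ Set.Icc p q, ∀ u ≥ C,
      g (u * Real.exp y) ≤ C * g u := by
  let A : ℕ → Set ℝ := fun n => {y | ∀ u ≥ (n : ℝ), g (u * Real.exp y) ≤ n * g u}
  have hclosed : ∀ n, IsClosed (A n) := by
    intro n
    simp only [A, Set.ofPred_forall]
    refine isClosed_iInter fun u => isClosed_iInter fun _ => ?_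
    exact isClosed_le (by fun_prop) continuous_const
  have hunion : ⋃ n, A n = Set.univ := by
    refine Set.eq_univ_of_forall fun y => Set.mem_iUnion.2 ?_
    have hev := (hrv (Real.exp y) (Real.exp_pos y)).eventually
      (eventually_le_nhds (lt_add_one (l (Real.exp y))))
    obtain ⟨T, hT⟩ := eventually_atTop.1 hev
    obtain ⟨n, hn⟩ := exists_nat_ge (max T (l (Real.exp y) + 1))
    refine ⟨n, fun u hu => ?_⟩
    have h1 := hT u (le_trans (le_trans (le_max_left _ _) hn) hu)
    exact (div_le_iff₀ (hpos u)).1 (h1.trans ((le_max_right _ _).trans hn))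
  obtain ⟨n, y, hy⟩ := nonempty_interior_of_iUnion_of_closed hclosed hunion
  obtain ⟨e, he, hball⟩ := Metric.nhds_basis_closedBall.mem_iff.1 (mem_interior_iff_mem_nhds.1 hy)
  rw [Real.closedBall_eq_Icc] at hball
  refine ⟨y - e, y + e, by linarith, n + 1, by positivity, fun z hz u hu => ?_⟩
  have h1 := hball hz u (by linarith)
  have := hpos u
  linarith

/-- Decay of a positive continuous regularly varying function of negative index. -/
theorem exists_ratio_le_of_tendsto_ratio_rpow {g : ℝ → ℝ} (hg : Continuous g)
    (hpos : ∀ t, 0 < g t) {β : ℝ} (hβ : 0 < β)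
    (hrv : ∀ x > (0 : ℝ), Tendsto (fun t => g (t * x) / g t) atTop (𝓝 (x ^ (-β)))) :
    ∃ R > (0 : ℝ), ∀ η > (0 : ℝ), ∃ L > (0 : ℝ), ∀ s ≥ R, ∀ t ≥ L * s, g t ≤ η * g s := by
  obtain ⟨p, q, hpq, C, hC, hbound⟩ := exists_Icc_ratio_le_of_tendsto_ratio hg hpos hrv
  set r := Real.exp (q - p) with hr
  have hr1 : 1 < r := Real.one_lt_exp_iff.2 (by linarith)
  have hr0 : 0 < r := by linarith
  obtain ⟨ρ, hρ, hρ1⟩ := exists_between (Real.rpow_lt_one_of_one_lt_of_neg hr1 (neg_lt_zero.2 hβ))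
  have hρ0 : 0 < ρ := (Real.rpow_pos_of_pos hr0 _).trans hρ
  obtain ⟨T, hT⟩ := eventually_atTop.1 ((hrv r hr0).eventually (eventually_le_nhds hρ))
  have hstep : ∀ k : ℕ, ∀ s > 0, s ≥ T → g (s * r ^ k) ≤ ρ ^ k * g s := by
    intro k s hs0 hs
    induction k with
    | zero => simp
    | succ k ih =>
      have hk : s ≤ s * r ^ k := le_mul_of_one_le_right hs0.le (one_le_pow₀ hr1.le)
      have h1 := (div_le_iff₀ (hpos _)).1 (hT (s * r ^ k) (hs.trans hk))
      calc g (s * r ^ (k + 1)) = g (s * r ^ k * r) := by rw [pow_succ, mul_assoc]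
        _ ≤ ρ * g (s * r ^ k) := h1
        _ ≤ ρ * (ρ ^ k * g s) := by gcongr
        _ = ρ ^ (k + 1) * g s := by ring
  refine ⟨max T C, lt_max_of_lt_right hC, fun η hη => ?_⟩
  obtain ⟨N, hN⟩ := exists_pow_lt_of_lt_one (div_pos hη hC) hρ1
  refine ⟨Real.exp p * r ^ N, by positivity, fun s hs t ht => ?_⟩
  have hsT : T ≤ s := (le_max_left _ _).trans hs
  have hsC : C ≤ s := (le_max_right _ _).trans hs
  have hs0 : 0 < s := hC.trans_le hsC
  have hp := Real.exp_pos p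
  have hxN : r ^ N ≤ t / (s * Real.exp p) := by
    rw [le_div_iff₀ (by positivity)]
    linarith
  obtain ⟨k, hk1, hk2⟩ := exists_nat_pow_near ((one_le_pow₀ hr1.le).trans hxN) hr1
  have hNk : N ≤ k := Nat.lt_succ_iff.1 ((pow_lt_pow_iff_right₀ hr1).1 (hxN.trans_lt hk2))
  have hsk : 0 < s * r ^ k := by positivity
  rw [le_div_iff₀ (by positivity)] at hk1
  rw [div_lt_iff₀ (by positivity)] at hk2
  have hlow : Real.exp p ≤ t / (s * r ^ k) := by
    rw [le_div_iff₀ hsk]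
    linarith
  have hhigh : t / (s * r ^ k) ≤ Real.exp q := by
    rw [div_le_iff₀ hsk]
    have hq : Real.exp q = r * Real.exp p := by rw [hr, ← Real.exp_add]; congr 1; ring
    rw [hq]
    refine hk2.le.trans_eq ?_
    ring
  have hy0 : 0 < t / (s * r ^ k) := hp.trans_le hlow
  have h1 := hbound (Real.log (t / (s * r ^ k)))
    ⟨(Real.le_log_iff_exp_le hy0).2 hlow, (Real.log_le_iff_le_exp hy0).2 hhigh⟩ (s * r ^ k)
    (hsC.trans (le_mul_of_one_le_right hs0.le (one_le_pow₀ hr1.le)))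
  rw [Real.exp_log hy0, mul_div_cancel₀ _ hsk.ne'] at h1
  have h2 : ρ ^ k ≤ η / C := (pow_le_pow_of_le_one hρ0.le hρ1.le hNk).trans hN.le
  calc g t ≤ C * g (s * r ^ k) := h1
    _ ≤ C * (ρ ^ k * g s) := by gcongr; exact hstep k s hs0 hsT
    _ ≤ C * (η / C * g s) := by have := hpos s; gcongr
    _ = η * g s := by field_simp

/-- The decay statement transfers to any function asymptotically proportional to a continuous
one. -/
theorem exists_ratio_le_of_tendsto_div {g h : ℝ → ℝ} (hg : Continuous g)
    (hgpos : ∀ t, 0 < g t) (hpos : ∀ t > 0, 0 < h t) {β c : ℝ} (hβ : 0 < β) (hc : 0 < c)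
    (hgh : Tendsto (fun t => g t / h t) atTop (𝓝 c))
    (hrv : ∀ x > (0 : ℝ), Tendsto (fun t => h (t * x) / h t) atTop (𝓝 (x ^ (-β)))) :
    ∃ R > (0 : ℝ), ∀ η > (0 : ℝ), ∃ L > (0 : ℝ), ∀ s ≥ R, ∀ t ≥ R, t ≥ L * s →
      h t ≤ η * h s := by
  have hgrv : ∀ x > (0 : ℝ), Tendsto (fun t => g (t * x) / g t) atTop (𝓝 (x ^ (-β))) := by
    intro x hx
    have h1 := ((hgh.comp (tendsto_id.atTop_mul_const hx)).mul (hrv x hx)).div hgh hc.ne'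
    rw [mul_div_cancel_left₀ _ hc.ne'] at h1
    refine h1.congr' ?_
    filter_upwards [eventually_gt_atTop 0] with t ht
    have := hpos t ht
    have := hpos (t * x) (mul_pos ht hx)
    have := hgpos t
    simp only [Pi.div_apply, Function.comp_apply, id]
    field_simp
  obtain ⟨R, hR, hdec⟩ := exists_ratio_le_of_tendsto_ratio_rpow hg hgpos hβ hgrv
  obtain ⟨T, hT⟩ := eventually_atTop.1 ((hgh.eventually (eventually_ge_nhds (half_lt_self hc))).and
    (hgh.eventually (eventually_le_nhds (lt_two_mul_self hc))))
  refine ⟨max R T, lt_max_of_lt_left hR, fun η hη => ?_⟩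
  obtain ⟨L, hL, hdec⟩ := hdec (η / 4) (by positivity)
  refine ⟨L, hL, fun s hs t ht hts => ?_⟩
  have hsR := (le_max_left R T).trans hs
  have h1 := hdec s hsR t hts
  have h2 := (le_div_iff₀ (hpos t (hR.trans_le ((le_max_left R T).trans ht)))).1
    (hT t ((le_max_right R T).trans ht)).1
  have h3 := (div_le_iff₀ (hpos s (hR.trans_le hsR))).1 (hT s ((le_max_right R T).trans hs)).2
  have h4 : c / 2 * h t ≤ c / 2 * (η * h s) :=
    calc c / 2 * h t ≤ η / 4 * g s := h2.trans h1
      _ ≤ η / 4 * (2 * c * h s) := by gcongr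
      _ = c / 2 * (η * h s) := by ring
  exact le_of_mul_le_mul_left h4 (by positivity)

/-- Lemma 2: If moreover `q > 0` on the unit sphere, then for each
`ε > 0` there exist `δ > 0` and `t₀ > 0` such that for `t > t₀`,
`{z : f(tz)/(t^{−d}V(t)) ≤ ε} ⊆ {z : ‖z‖ > δ}`. -/
theorem extreme_risk_low_density_away_from_origin
    (d : ℕ) (hd : 2 ≤ d)
    (P : Measure (EuclideanSpace ℝ (Fin d))) [IsProbabilityMeasure P]
    (f : EuclideanSpace ℝ (Fin d) → ℝ)
    (hf_cont : Continuous f) (hf_pos : ∀ z, 0 < f z)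
    (hP : P = volume.withDensity (fun z => ENNReal.ofReal (f z)))
    (α : ℝ) (hα : 0 < α)
    (V : ℝ → ℝ) (hV_pos : ∀ t > (0 : ℝ), 0 < V t)
    (hV_rv : ∀ x > (0 : ℝ),
      Tendsto (fun t => V (t * x) / V t) atTop (𝓝 (x ^ (-α))))
    (q : EuclideanSpace ℝ (Fin d) → ℝ)
    (hq_nonneg : ∀ z : EuclideanSpace ℝ (Fin d), z ≠ 0 → 0 ≤ q z)
    (hq_lim : ∀ z : EuclideanSpace ℝ (Fin d), z ≠ 0 →
      Tendsto (fun t : ℝ => f (t • z) / (t ^ (-(d : ℝ)) * V t)) atTop (𝓝 (q z)))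
    (hq_unif : ∀ δ > (0 : ℝ), ∃ t₀ > (0 : ℝ), ∀ t ≥ t₀,
      ∀ z : EuclideanSpace ℝ (Fin d), ‖z‖ = 1 →
        |f (t • z) / (t ^ (-(d : ℝ)) * V t) - q z| ≤ δ)
    (hq_pos : ∀ w : EuclideanSpace ℝ (Fin d), ‖w‖ = 1 → 0 < q w) :
    ∀ ε > (0 : ℝ), ∃ δ > (0 : ℝ), ∃ t₀ > (0 : ℝ), ∀ t > t₀,
      {z : EuclideanSpace ℝ (Fin d) | f (t • z) / (t ^ (-(d : ℝ)) * V t) ≤ ε} ⊆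
        {z : EuclideanSpace ℝ (Fin d) | δ < ‖z‖} := by
  set h : ℝ → ℝ := fun t => t ^ (-(d : ℝ)) * V t with hh
  have hpos : ∀ t > (0 : ℝ), 0 < h t := fun t ht =>
    mul_pos (Real.rpow_pos_of_pos ht _) (hV_pos t ht)
  have hrv : ∀ x > (0 : ℝ), Tendsto (fun t => h (t * x) / h t) atTop
      (𝓝 (x ^ (-((d : ℝ) + α)))) := by
    intro x hx
    rw [neg_add, Real.rpow_add hx]
    refine ((hV_rv x hx).const_mul (x ^ (-(d : ℝ)))).congr' ?_
    filter_upwards [eventually_gt_atTop 0] with t ht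
    have := Real.rpow_pos_of_pos ht (-(d : ℝ))
    have := hV_pos t ht
    simp only [hh, Real.mul_rpow ht.le hx.le]
    field_simp
  let w₀ : EuclideanSpace ℝ (Fin d) := EuclideanSpace.single ⟨0, by omega⟩ 1
  have hw₀ : ‖w₀‖ = 1 := by simp [w₀]
  obtain ⟨R, hR, hdec⟩ := exists_ratio_le_of_tendsto_div (g := fun t => f (t • w₀)) (by fun_prop)
    (fun t => hf_pos _) hpos (by positivity) (hq_pos w₀ hw₀)
    (hq_lim w₀ (norm_ne_zero_iff.1 (by simp [hw₀]))) hrv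
  have hq_cont : ContinuousOn q (Metric.sphere 0 1) := by
    have hu : TendstoUniformlyOn (fun (t : ℝ) z => f (t • z) / h t) q atTop
        (Metric.sphere 0 1) := by
      rw [Metric.tendstoUniformlyOn_iff]
      intro e he
      obtain ⟨t₀, -, ht₀⟩ := hq_unif (e / 2) (half_pos he)
      filter_upwards [eventually_ge_atTop t₀] with t ht z hz
      rw [dist_comm, Real.dist_eq]
      exact (ht₀ t ht z (by simpa using hz)).trans_lt (half_lt_self he)
    exact hu.continuousOn (Frequently.of_forall fun t => by fun_prop)
  obtain ⟨w₁, hw₁, hmin⟩ := (isCompact_sphere (0 : EuclideanSpace ℝ (Fin d)) 1).exists_isMinOn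
    ⟨w₀, by simpa using hw₀⟩ hq_cont
  have hm : 0 < q w₁ := hq_pos w₁ (by simpa using hw₁)
  obtain ⟨T, hT, hunif⟩ := hq_unif (q w₁ / 2) (half_pos hm)
  have hlow : ∀ s ≥ T, ∀ w : EuclideanSpace ℝ (Fin d), ‖w‖ = 1 →
      q w₁ / 2 * h s ≤ f (s • w) := by
    intro s hs w hw
    have h1 := (abs_le.1 (hunif s hs w hw)).1
    have h2 : q w₁ ≤ q w := hmin (by simpa using hw)
    rw [← le_div_iff₀ (hpos s (hT.trans_le hs))]
    simp only [hh]
    linarith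
  intro ε hε
  set S := max R T
  have hS : 0 < S := lt_max_of_lt_left hR
  obtain ⟨w₂, -, hmin₂⟩ := (isCompact_closedBall (0 : EuclideanSpace ℝ (Fin d)) S).exists_isMinOn
    ⟨0, by simp [hS.le]⟩ hf_cont.continuousOn
  obtain ⟨L₁, hL₁, hdec₁⟩ := hdec (q w₁ / (4 * ε)) (by positivity)
  obtain ⟨L₂, hL₂, hdec₂⟩ := hdec (f w₂ / (2 * ε * h S))
    (div_pos (hf_pos _) (mul_pos (by positivity) (hpos S hS)))
  refine ⟨1 / L₁, by positivity, max S (L₂ * S), lt_max_of_lt_left hS, fun t ht z hz => ?_⟩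
  have htS : S < t := (le_max_left _ _).trans_lt ht
  have ht0 : 0 < t := hS.trans htS
  have htR : R ≤ t := (le_max_left R T).trans htS.le
  have hht := hpos t ht0
  have hz' : f (t • z) ≤ ε * h t := (div_le_iff₀ hht).1 hz
  by_contra hcon
  have hzL : ‖z‖ ≤ 1 / L₁ := not_lt.1 hcon
  rcases le_total (t * ‖z‖) S with hs | hs
  · have h1 : f w₂ ≤ f (t • z) := hmin₂ (by simpa [norm_smul, abs_of_pos ht0] using hs)
    have h2 := hdec₂ S (le_max_left _ _) t htR ((le_max_right _ _).trans ht.le)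
    have h3 : ε * (f w₂ / (2 * ε * h S) * h S) = f w₂ / 2 := by
      have := hpos S hS
      field_simp
    have h4 := mul_le_mul_of_nonneg_left h2 hε.le
    have := hf_pos w₂
    linarith
  · have hzn : 0 < ‖z‖ := pos_of_mul_pos_right (hS.trans_le hs) ht0.le
    have h1 := hlow (t * ‖z‖) ((le_max_right _ _).trans hs) (‖z‖⁻¹ • z)
      (by rw [norm_smul, norm_inv, norm_norm, inv_mul_cancel₀ hzn.ne'])
    rw [smul_smul, mul_assoc, mul_inv_cancel₀ hzn.ne', mul_one] at h1
    have h2 := hdec₁ (t * ‖z‖) ((le_max_left _ _).trans hs) t htR (by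
      rw [le_div_iff₀ hL₁] at hzL
      nlinarith)
    have h3 : ε * (q w₁ / (4 * ε) * h (t * ‖z‖)) = q w₁ / 2 * h (t * ‖z‖) / 2 := by
      field_simp
      ring
    have h4 := mul_le_mul_of_nonneg_left h2 hε.le
    have := mul_pos (half_pos hm) (hpos _ (hS.trans_le hs))
    linarith
end

section
/- For every ε ∈ (0,1) there is n₀ such that for all n ≥ n₀: U(ν(S)/p) · { z : q(z) ≤ 1 − ε } ⊂ Q̃_n ⊂ U(ν(S)/p) · { z : q(z) ≤ 1 + ε }, where Q̃_n = U(n/k) · (kν(S)/(np))^{1/α} · S. -/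
open MeasureTheory Filter Topology Pointwise

/-- Rescaled sublevel sets of a function that is homogeneous of degree `β`. -/
theorem smul_sublevel_subset_smul_sublevel {E : Type*} [AddCommGroup E] [Module ℝ E]
    {q : E → ℝ} {β : ℝ}
    (hq : ∀ a > (0 : ℝ), ∀ z : E, z ≠ 0 → q (a • z) = a ^ β * q z)
    {a b s t : ℝ} (ha : 0 < a) (hb : 0 < b) (h : (b / a) ^ β * s ≤ t) :
    b • {z : E | z ≠ 0 ∧ q z ≤ s} ⊆ a • {z : E | z ≠ 0 ∧ q z ≤ t} := by
  rintro _ ⟨z, ⟨hz, hqz⟩, rfl⟩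
  have hba : 0 < b / a := div_pos hb ha
  refine ⟨(b / a) • z, ⟨smul_ne_zero hba.ne' hz, ?_⟩, ?_⟩
  · rw [hq _ hba z hz]
    exact (mul_le_mul_of_nonneg_left hqz (Real.rpow_nonneg hba.le β)).trans h
  · simp only [smul_smul, mul_div_cancel₀ b ha.ne']

/-- If `U` is asymptotic to `c x ^ γ`, then `U x (y / x) ^ γ` is asymptotic to `U y`. -/
theorem tendsto_mul_rpow_div_of_tendsto_div_rpow {ι : Type*} {l : Filter ι} {U : ℝ → ℝ}
    {c γ : ℝ} (hc : c ≠ 0) (hU : Tendsto (fun t : ℝ => U t / t ^ γ) atTop (𝓝 c))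
    {x y : ι → ℝ} (hx : Tendsto x l atTop) (hy : Tendsto y l atTop) :
    Tendsto (fun i => U (x i) * (y i / x i) ^ γ / U (y i)) l (𝓝 1) := by
  have h := (hU.comp hx).div (hU.comp hy) hc
  rw [div_self hc] at h
  refine h.congr' ?_
  filter_upwards [hx.eventually_gt_atTop 0, hy.eventually_gt_atTop 0] with i hxi hyi
  simp only [Function.comp_apply, Pi.div_apply]
  rw [Real.div_rpow hyi.le hxi.le, div_div_eq_mul_div, div_mul_eq_mul_div, mul_div_assoc]

/-- Lemma 4: For every `ε ∈ (0,1)` and all large `n`,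
`U(ν(S)/p){z : q(z) ≤ 1−ε} ⊆ Q̃_n ⊆ U(ν(S)/p){z : q(z) ≤ 1+ε}`, where
`Q̃_n = U(n/k)(kν(S)/(np))^{1/α} S`. -/
theorem extreme_risk_Qtilde_sandwich
    (d : ℕ) (hd : 2 ≤ d)
    (P : Measure (EuclideanSpace ℝ (Fin d))) [IsProbabilityMeasure P]
    (f : EuclideanSpace ℝ (Fin d) → ℝ)
    (hf_cont : Continuous f) (hf_pos : ∀ z, 0 < f z)
    (hP : P = volume.withDensity (fun z => ENNReal.ofReal (f z)))
    (α : ℝ) (hα : 0 < α)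
    -- V = 1 − H, regularly varying with index −α
    (V : ℝ → ℝ)
    (hV_def : ∀ t : ℝ, V t = (P {z | t < ‖z‖}).toReal)
    (hV_rv : ∀ x > (0 : ℝ),
      Tendsto (fun t => V (t * x) / V t) atTop (𝓝 (x ^ (-α))))
    (q : EuclideanSpace ℝ (Fin d) → ℝ)
    (hq_nonneg : ∀ z : EuclideanSpace ℝ (Fin d), z ≠ 0 → 0 ≤ q z)
    (hq_lim : ∀ z : EuclideanSpace ℝ (Fin d), z ≠ 0 →
      Tendsto (fun t : ℝ => f (t • z) / (t ^ (-(d : ℝ)) * V t)) atTop (𝓝 (q z)))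
    (hq_unif : ∀ δ > (0 : ℝ), ∃ t₀ > (0 : ℝ), ∀ t ≥ t₀,
      ∀ z : EuclideanSpace ℝ (Fin d), ‖z‖ = 1 →
        |f (t • z) / (t ^ (-(d : ℝ)) * V t) - q z| ≤ δ)
    (hq_hom : ∀ a > (0 : ℝ), ∀ z : EuclideanSpace ℝ (Fin d), z ≠ 0 →
      q (a • z) = a ^ (-(d : ℝ) - α) * q z)
    -- ν(S) ∈ (0,∞), S = {z ≠ 0 : q(z) ≤ 1}
    (hS_int : IntegrableOn q {z : EuclideanSpace ℝ (Fin d) | z ≠ 0 ∧ q z ≤ 1} volume)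
    (νS : ℝ) (hνS : νS = ∫ z in {z : EuclideanSpace ℝ (Fin d) | z ≠ 0 ∧ q z ≤ 1}, q z)
    (hνS_pos : 0 < νS)
    -- the quantile function U(t) = H⁻¹(1 − 1/t), satisfying condition (c)
    (U : ℝ → ℝ)
    (hU : ∀ t > (1 : ℝ), P {z | ‖z‖ ≤ U t} = ENNReal.ofReal (1 - 1 / t))
    (c : ℝ) (hc : 0 < c)
    (hUc : Tendsto (fun t : ℝ => U t / t ^ (1 / α)) atTop (𝓝 c))
    -- condition (b) and p → 0
    (k : ℕ → ℕ) (hk_pos : ∀ n, 0 < k n)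
    (hk_top : Tendsto (fun n => (k n : ℝ)) atTop atTop)
    (hkn : Tendsto (fun n => (k n : ℝ) / n) atTop (𝓝 0))
    (p : ℕ → ℝ) (hp_mem : ∀ n, p n ∈ Set.Ioo (0 : ℝ) 1)
    (hp0 : Tendsto p atTop (𝓝 0)) :
    ∀ ε ∈ Set.Ioo (0 : ℝ) 1, ∃ n₀ : ℕ, ∀ n ≥ n₀,
      U (νS / p n) • {z : EuclideanSpace ℝ (Fin d) | z ≠ 0 ∧ q z ≤ 1 - ε} ⊆
        (U ((n : ℝ) / k n) * ((k n * νS) / (n * p n)) ^ (1 / α)) •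
          {z : EuclideanSpace ℝ (Fin d) | z ≠ 0 ∧ q z ≤ 1} ∧
      (U ((n : ℝ) / k n) * ((k n * νS) / (n * p n)) ^ (1 / α)) •
          {z : EuclideanSpace ℝ (Fin d) | z ≠ 0 ∧ q z ≤ 1} ⊆
        U (νS / p n) • {z : EuclideanSpace ℝ (Fin d) | z ≠ 0 ∧ q z ≤ 1 + ε} := by
  rintro ε ⟨hε0, hε1⟩
  have hUpos : ∀ᶠ t in atTop, 0 < U t := by
    filter_upwards [hUc.eventually_const_lt hc, eventually_gt_atTop 0] with t ht ht0
    exact (div_pos_iff_of_pos_right (Real.rpow_pos_of_pos ht0 _)).1 ht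
  have hx : Tendsto (fun n : ℕ => (n : ℝ) / k n) atTop atTop := by
    have h : Tendsto (fun n => (k n : ℝ) / n) atTop (𝓝[>] 0) := by
      refine tendsto_nhdsWithin_iff.2 ⟨hkn, ?_⟩
      filter_upwards [eventually_gt_atTop 0] with n hn
      have hn' : (0 : ℝ) < n := Nat.cast_pos.2 hn
      have hk' : (0 : ℝ) < k n := Nat.cast_pos.2 (hk_pos n)
      exact div_pos hk' hn'
    exact h.inv_tendsto_nhdsGT_zero.congr fun n => inv_div _ _
  have hy : Tendsto (fun n => νS / p n) atTop atTop := by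
    have h : Tendsto p atTop (𝓝[>] 0) :=
      tendsto_nhdsWithin_iff.2 ⟨hp0, Eventually.of_forall fun n => (hp_mem n).1⟩
    exact h.inv_tendsto_nhdsGT_zero.const_mul_atTop hνS_pos
  have hr := tendsto_mul_rpow_div_of_tendsto_div_rpow hc.ne' hUc hx hy
  have hpow : Tendsto (fun r : ℝ => r ^ (-(d : ℝ) - α)) (𝓝 1) (𝓝 1) := by
    simpa using (Real.continuousAt_rpow_const 1 (-(d : ℝ) - α) (Or.inl one_ne_zero)).tendsto
  have hinv := hr.inv₀ one_ne_zero
  rw [inv_one] at hinv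
  have hlower := ((hpow.comp hinv).mul_const (1 - ε)).eventually_lt_const
    (show 1 * (1 - ε) < 1 by linarith)
  have hupper := (hpow.comp hr).eventually_lt_const (show 1 < 1 + ε by linarith)
  refine eventually_atTop.1 ?_
  filter_upwards [hlower, hupper, hx.eventually hUpos, hy.eventually hUpos,
    eventually_gt_atTop 0] with n hl hu hUx hUy hn
  have hn' : (0 : ℝ) < n := Nat.cast_pos.2 hn
  have hk' : (0 : ℝ) < k n := Nat.cast_pos.2 (hk_pos n)
  have hp' : 0 < p n := (hp_mem n).1
  have hyx : νS / p n / (n / k n) = k n * νS / (n * p n) := by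
    field_simp
  simp only [Function.comp_apply, hyx, inv_div] at hl hu
  have ha : 0 < U (n / k n) * (k n * νS / (n * p n)) ^ (1 / α) := by positivity
  exact ⟨smul_sublevel_subset_smul_sublevel hq_hom ha hUy hl.le,
    smul_sublevel_subset_smul_sublevel hq_hom hUy ha (by rw [mul_one]; exact hu.le)⟩
end

section
/- Let β_n > 0 be such that the set Q_n = { z ∈ ℝ^d : f(z) ≤ β_n } satisfies P(Q_n) = p_n, and let Q̃_n = U(n/k) · (kν(S)/(np))^{1/α} · S. Then lim_{n→∞} P(Q_n △ Q̃_n)/p_n = 0, where △ denotes symmetric difference. -/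
open MeasureTheory Filter Topology Pointwise symmDiff

/-- If the quantile function `U` of the survival function `V` satisfies `U t ∼ c t ^ (1 / α)`, then
`V t ∼ (t / c) ^ (-α)`. -/
theorem tendsto_survival_mul_rpow {α c : ℝ} (hα : 0 < α) (hc : 0 < c) {V U : ℝ → ℝ}
    (hV : Antitone V) (hVU : ∀ t > 1, V (U t) = 1 / t)
    (hU : Tendsto (fun t => U t / t ^ (1 / α)) atTop (𝓝 c)) :
    Tendsto (fun t => V t * t ^ α) atTop (𝓝 (c ^ α)) := by
  have key : ∀ e : ℝ, 0 < e → Tendsto (fun t => (t / e) ^ α) atTop atTop := fun e he =>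
    (tendsto_rpow_atTop hα).comp (tendsto_id.atTop_div_const he)
  have hroot : ∀ e : ℝ, 0 < e → ∀ t : ℝ, 0 < t → ((t / e) ^ α) ^ (1 / α) = t / e := by
    intro e he t ht
    rw [one_div, Real.rpow_rpow_inv (by positivity) hα.ne']
  have hmul : ∀ e : ℝ, 0 < e → ∀ t : ℝ, 0 < t → 1 / (t / e) ^ α * t ^ α = e ^ α := by
    intro e he t ht
    rw [Real.div_rpow ht.le he.le]
    have := Real.rpow_pos_of_pos ht α
    have := Real.rpow_pos_of_pos he α
    field_simp
  have hcont : ContinuousAt (fun e : ℝ => e ^ α) c :=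
    Real.continuousAt_rpow_const c α (Or.inl hc.ne')
  refine tendsto_order.2 ⟨fun a ha => ?_, fun a ha => ?_⟩
  · obtain ⟨e, ⟨hea, he0⟩, hec⟩ : ∃ e, (a < e ^ α ∧ 0 < e) ∧ e < c :=
      (((hcont.eventually_const_lt ha).and (eventually_gt_nhds hc)).filter_mono
        nhdsWithin_le_nhds |>.and self_mem_nhdsWithin : ∀ᶠ e in 𝓝[<] c, _).exists
    filter_upwards [(key e he0).eventually (hU.eventually_const_lt hec),
      (key e he0).eventually_gt_atTop 1, eventually_gt_atTop 0] with t h1 h2 h3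
    rw [hroot e he0 t h3, lt_div_iff₀ (by positivity), mul_div_cancel₀ _ he0.ne'] at h1
    have h4 := mul_le_mul_of_nonneg_right (hV h1.le) (Real.rpow_nonneg h3.le α)
    rw [hVU _ h2, hmul e he0 t h3] at h4
    linarith
  · obtain ⟨e, hea, hec⟩ : ∃ e, e ^ α < a ∧ c < e :=
      ((hcont.eventually_lt_const ha).filter_mono
        nhdsWithin_le_nhds |>.and self_mem_nhdsWithin : ∀ᶠ e in 𝓝[>] c, _).exists
    have he0 := hc.trans hec
    filter_upwards [(key e he0).eventually (hU.eventually_lt_const hec),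
      (key e he0).eventually_gt_atTop 1, eventually_gt_atTop 0] with t h1 h2 h3
    rw [hroot e he0 t h3, div_lt_iff₀ (by positivity), mul_div_cancel₀ _ he0.ne'] at h1
    have h4 := mul_le_mul_of_nonneg_right (hV h1.le) (Real.rpow_nonneg h3.le α)
    rw [hVU _ h2, hmul e he0 t h3] at h4
    linarith

theorem eventually_sublevel_norm_ge_of_pos {E : Type*} [NormedAddCommGroup E] [ProperSpace E]
    {f : E → ℝ} (hf : Continuous f) (hpos : ∀ z, 0 < f z) {u : ℝ → ℝ} (hu : Tendsto u atTop (𝓝 0)) (R : ℝ) :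
    ∀ᶠ r : ℝ in atTop, ∀ z : E, f z ≤ u r → R ≤ ‖z‖ := by
  obtain ⟨a, ha, hfa⟩ := (isCompact_closedBall (0 : E) R).exists_forall_le' hf.continuousOn
    (a := 0) fun z _ => hpos z
  filter_upwards [hu.eventually_lt_const ha] with r hr z hz
  by_contra! hzR
  have := hfa z (by simpa using hzR.le)
  linarith

theorem measurableSet_sublevel {E : Type*} [NormedAddCommGroup E] [MeasurableSpace E]
    [BorelSpace E] {q : E → ℝ} (hq : ContinuousOn q {0}ᶜ) (b : ℝ) :
    MeasurableSet {z : E | z ≠ 0 ∧ q z ≤ b} := by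
  have h1 := (hq.isOpen_inter_preimage isOpen_compl_singleton (isOpen_Ioi (a := b))).measurableSet
  have h2 : {z : E | z ≠ 0 ∧ q z ≤ b} = {0}ᶜ \ ({0}ᶜ ∩ q ⁻¹' Set.Ioi b) := by
    ext z
    simp
  rw [h2]
  exact isOpen_compl_singleton.measurableSet.diff h1

section

variable {E : Type*} [NormedAddCommGroup E] [NormedSpace ℝ E]

/-- A radial limit with power normalisation is homogeneous. -/
theorem homogeneous_of_tendsto {f q : E → ℝ} {C γ : ℝ} (hC : 0 < C)
    (h : ∀ z : E, z ≠ 0 → Tendsto (fun t : ℝ => t ^ γ * f (t • z)) atTop (𝓝 (C * q z)))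
    {s : ℝ} (hs : 0 < s) {z : E} (hz : z ≠ 0) : q (s • z) = s ^ (-γ) * q z := by
  have h1 := h (s • z) (smul_ne_zero hs.ne' hz)
  have h2 := ((h z hz).comp (tendsto_id.atTop_mul_const hs)).const_mul (s ^ (-γ))
  have h3 : (fun t : ℝ => s ^ (-γ) * ((fun t : ℝ => t ^ γ * f (t • z)) ∘ fun t => id t * s) t)
      =ᶠ[atTop] fun t => t ^ γ * f (t • s • z) := by
    filter_upwards [eventually_ge_atTop 0] with t ht
    simp only [Function.comp_apply, id]
    rw [Real.mul_rpow ht hs.le, Real.rpow_neg hs.le, smul_smul]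
    have := Real.rpow_pos_of_pos hs γ
    field_simp
  have h4 := tendsto_nhds_unique h1 (h2.congr' h3)
  have : C * q (s • z) = C * (s ^ (-γ) * q z) := by rw [h4]; ring
  exact mul_left_cancel₀ hC.ne' this

theorem eq_rpow_norm_mul {q : E → ℝ} {γ : ℝ}
    (hq : ∀ s : ℝ, 0 < s → ∀ z : E, z ≠ 0 → q (s • z) = s ^ (-γ) * q z) {z : E} (hz : z ≠ 0) :
    q z = ‖z‖ ^ (-γ) * q (‖z‖⁻¹ • z) := by
  have hz' := norm_pos_iff.2 hz
  rw [← hq _ hz' _ (smul_ne_zero (inv_ne_zero hz'.ne') hz), smul_smul, mul_inv_cancel₀ hz'.ne',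
    one_smul]

theorem continuousOn_compl_zero_of_homogeneous {q : E → ℝ} {γ : ℝ}
    (hq : ∀ s : ℝ, 0 < s → ∀ z : E, z ≠ 0 → q (s • z) = s ^ (-γ) * q z)
    (hc : ContinuousOn q (Metric.sphere 0 1)) : ContinuousOn q {0}ᶜ := by
  have h : ContinuousOn (fun z : E => ‖z‖ ^ (-γ) * q (‖z‖⁻¹ • z)) {0}ᶜ := by
    refine ContinuousOn.mul ?_ (hc.comp ?_ ?_)
    · exact continuous_norm.continuousOn.rpow_const fun z hz => Or.inl (norm_ne_zero_iff.2 hz)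
    · exact (continuous_norm.continuousOn.inv₀ fun z hz => norm_ne_zero_iff.2 hz).smul
        continuousOn_id
    · intro z hz
      have : ‖z‖ ≠ 0 := norm_ne_zero_iff.2 hz
      simp [norm_smul, this]
  exact h.congr fun z hz => eq_rpow_norm_mul hq hz

/-- The sublevel set `{q ≤ r ^ (-γ)}` of a homogeneous function is the dilate of `{q ≤ 1}`. -/
theorem smul_sublevel_of_homogeneous {q : E → ℝ} {γ : ℝ}
    (hq : ∀ s : ℝ, 0 < s → ∀ z : E, z ≠ 0 → q (s • z) = s ^ (-γ) * q z) {r : ℝ} (hr : 0 < r) :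
    r • {z : E | z ≠ 0 ∧ q z ≤ 1} = {z : E | z ≠ 0 ∧ q z ≤ r ^ (-γ)} := by
  ext z
  rw [Set.mem_smul_set_iff_inv_smul_mem₀ hr.ne']
  simp only [Set.mem_ofPred_eq, ne_eq, smul_eq_zero, inv_eq_zero, hr.ne', false_or]
  refine and_congr_right fun hz => ?_
  rw [hq _ (inv_pos.2 hr) _ hz, Real.inv_rpow hr.le, inv_mul_le_iff₀ (by positivity), mul_one]

theorem exists_norm_ge_ratio {f q : E → ℝ} {V : ℝ → ℝ} {C α d m : ℝ} (hC : 0 < C) (hm : 0 < m)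
    (hqm : ∀ w : E, ‖w‖ = 1 → m ≤ q w)
    (hq : ∀ s : ℝ, 0 < s → ∀ z : E, z ≠ 0 → q (s • z) = s ^ (-(d + α)) * q z)
    (hV : Tendsto (fun t => V t * t ^ α) atTop (𝓝 C))
    (hunif : ∀ δ > (0 : ℝ), ∃ t₀ > (0 : ℝ), ∀ t ≥ t₀, ∀ z : E, ‖z‖ = 1 →
        |f (t • z) / (t ^ (-d) * V t) - q z| ≤ δ)
    {l : ℝ} (hl : 1 < l) :
    ∃ R > 0, ∀ z : E, R ≤ ‖z‖ → C * q z ≤ l * f z ∧ f z ≤ l * (C * q z) := by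
  obtain ⟨ε, ⟨h1, h2⟩, hε1, hε0⟩ : ∃ ε : ℝ, ((1 + ε) * (1 + ε) < l ∧ 1 < l * ((1 - ε) * (1 - ε)))
      ∧ ε < 1 ∧ 0 < ε := by
    have c1 : ContinuousAt (fun ε : ℝ => (1 + ε) * (1 + ε)) 0 := by fun_prop
    have c2 : ContinuousAt (fun ε : ℝ => l * ((1 - ε) * (1 - ε))) 0 := by fun_prop
    have e1 := c1.eventually_lt_const (u := l) (by simpa using hl)
    have e2 := c2.eventually_const_lt (u := 1) (by simpa using hl)
    exact (((e1.and e2).and (eventually_lt_nhds one_pos)).filter_mono nhdsWithin_le_nhds |>.and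
      self_mem_nhdsWithin : ∀ᶠ ε in 𝓝[>] (0 : ℝ), _).exists.imp fun ε h => ⟨h.1.1, h.1.2, h.2⟩
  obtain ⟨t₀, ht₀, hf⟩ := hunif (ε * m) (by positivity)
  have hVl := hV.eventually_const_lt (u := (1 - ε) * C) (by nlinarith)
  have hVu := hV.eventually_lt_const (u := (1 + ε) * C) (by nlinarith)
  obtain ⟨t₁, ht₁⟩ := eventually_atTop.1 (hVl.and hVu)
  refine ⟨max t₀ t₁, lt_max_of_lt_left ht₀, fun z hz => ?_⟩
  have htz : 0 < ‖z‖ := ht₀.trans_le ((le_max_left _ _).trans hz)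
  have hz0 : z ≠ 0 := norm_pos_iff.1 htz
  set t := ‖z‖
  set w := t⁻¹ • z
  have hw : ‖w‖ = 1 := by simp [w, norm_smul, t, hz0]
  have htw : t • w = z := by simp [w, smul_smul, htz.ne']
  have hqz := eq_rpow_norm_mul hq hz0
  change q z = t ^ (-(d + α)) * q w at hqz
  have hfw := abs_le.1 (hf t ((le_max_left _ _).trans hz) w hw)
  obtain ⟨hv1, hv2⟩ := ht₁ t ((le_max_right _ _).trans hz)
  rw [htw] at hfw
  have hmq := hqm w hw
  have ha : 0 < t ^ α := Real.rpow_pos_of_pos htz _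
  have hd : 0 < t ^ (-d) := Real.rpow_pos_of_pos htz _
  have hva : 0 < V t * t ^ α := (mul_pos (by linarith) hC).trans hv1
  have hv : 0 < V t := (pos_iff_pos_of_mul_pos hva).2 ha
  have hsplit : t ^ (-(d + α)) = t ^ (-d) * (t ^ α)⁻¹ := by
    rw [neg_add, Real.rpow_add htz, Real.rpow_neg htz.le α]
  have hb : 0 < t ^ (-(d + α)) := Real.rpow_pos_of_pos htz _
  have hden : t ^ (-d) * V t = t ^ (-(d + α)) * (V t * t ^ α) := by
    rw [hsplit]; field_simp
  have hq0 : 0 < q w := hm.trans_le hmq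
  set b := t ^ (-(d + α))
  set v := V t * t ^ α
  rw [hden] at hfw
  have hbv : 0 < b * v := mul_pos hb hva
  have f1 : f z ≤ (1 + ε) * q w * (b * v) := by
    rw [← div_le_iff₀ hbv]; nlinarith
  have f2 : (1 - ε) * q w * (b * v) ≤ f z := by
    rw [← le_div_iff₀ hbv]; nlinarith
  have hqb : 0 < q w * b := mul_pos hq0 hb
  rw [hqz]
  constructor
  · have : (1 - ε) * (q w * b) * ((1 - ε) * C) ≤ (1 - ε) * (q w * b) * v :=
      mul_le_mul_of_nonneg_left hv1.le (mul_nonneg (by linarith) hqb.le)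
    have h3 : (1 - ε) * (1 - ε) * (C * (q w * b)) ≤ f z := by linarith
    have h4 := mul_le_mul_of_nonneg_left h3 (by linarith : 0 ≤ l)
    have h5 := mul_le_mul_of_nonneg_right h2.le (mul_pos hC hqb).le
    linarith
  · have : (1 + ε) * (q w * b) * v ≤ (1 + ε) * (q w * b) * ((1 + ε) * C) :=
      mul_le_mul_of_nonneg_left hv2.le (mul_nonneg (by linarith) hqb.le)
    have h5 := mul_le_mul_of_nonneg_right h1.le (mul_pos hC hqb).le
    linarith

theorem eventually_sublevel_subset_norm_ge {q : E → ℝ} {γ m : ℝ} (hγ : 0 < γ) (hm : 0 < m)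
    (hqm : ∀ w : E, ‖w‖ = 1 → m ≤ q w)
    (hq : ∀ s : ℝ, 0 < s → ∀ z : E, z ≠ 0 → q (s • z) = s ^ (-γ) * q z) {R : ℝ} (hR : 0 < R) :
    ∀ᶠ r : ℝ in atTop, ∀ z : E, z ≠ 0 → q z ≤ r ^ (-γ) → R ≤ ‖z‖ := by
  filter_upwards [(tendsto_rpow_neg_atTop hγ).eventually_lt_const
    (u := R ^ (-γ) * m) (by positivity)] with r hr z hz hqz
  by_contra! hzR
  have hz' := norm_pos_iff.2 hz
  have h1 := eq_rpow_norm_mul hq hz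
  have h2 : m ≤ q (‖z‖⁻¹ • z) := hqm _ (by simp [norm_smul, hz'.ne'])
  have h3 : R ^ (-γ) ≤ ‖z‖ ^ (-γ) :=
    Real.rpow_le_rpow_of_nonpos hz' hzR.le (by linarith)
  have h4 := mul_le_mul h3 h2 hm.le (by positivity)
  linarith

/-- The level sets of `f` are sandwiched between dilates of the level set of its limit `q`. -/
theorem eventually_sublevel_sandwich [ProperSpace E] {f q : E → ℝ} {C γ m : ℝ} (hC : 0 < C)
    (hγ : 0 < γ) (hm : 0 < m) (hf : Continuous f) (hpos : ∀ z, 0 < f z)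
    (hqm : ∀ w : E, ‖w‖ = 1 → m ≤ q w)
    (hq : ∀ s : ℝ, 0 < s → ∀ z : E, z ≠ 0 → q (s • z) = s ^ (-γ) * q z)
    (hratio : ∀ l : ℝ, 1 < l → ∃ R > 0, ∀ z : E, R ≤ ‖z‖ →
      C * q z ≤ l * f z ∧ f z ≤ l * (C * q z)) {l : ℝ} (hl : 1 < l) :
    ∀ᶠ r : ℝ in atTop, {z : E | z ≠ 0 ∧ q z ≤ (l * r) ^ (-γ)} ⊆ {z | f z ≤ C * r ^ (-γ)} ∧
      {z | f z ≤ C * r ^ (-γ)} ⊆ {z : E | z ≠ 0 ∧ q z ≤ (r / l) ^ (-γ)} := by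
  have hl0 : 0 < l := by linarith
  obtain ⟨R, hR, hfq⟩ := hratio (l ^ γ) (Real.one_lt_rpow hl hγ)
  have hu : Tendsto (fun r : ℝ => C * r ^ (-γ)) atTop (𝓝 0) := by
    simpa using (tendsto_rpow_neg_atTop hγ).const_mul C
  filter_upwards [eventually_gt_atTop 0, eventually_sublevel_norm_ge_of_pos hf hpos hu R,
    (tendsto_id.const_mul_atTop hl0).eventually
      (eventually_sublevel_subset_norm_ge hγ hm hqm hq hR)] with r hr h1 h2
  have hlg : 0 < l ^ γ := Real.rpow_pos_of_pos hl0 γ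
  refine ⟨?_, ?_⟩
  · rintro z ⟨hz, hqz⟩
    have h3 := (hfq z (h2 z hz hqz)).2
    have h4 : (l * r) ^ (-γ) = (l ^ γ)⁻¹ * r ^ (-γ) := by
      rw [Real.mul_rpow hl0.le hr.le, Real.rpow_neg hl0.le]
    rw [h4] at hqz
    have h5 : l ^ γ * q z ≤ r ^ (-γ) := by
      rwa [le_inv_mul_iff₀ hlg] at hqz
    have h6 := mul_le_mul_of_nonneg_left h5 hC.le
    change f z ≤ _
    linarith
  · intro z hz
    have hzR := h1 z hz
    refine ⟨norm_pos_iff.1 (hR.trans_le hzR), ?_⟩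
    have h3 := (hfq z hzR).1
    have h4 : (r / l) ^ (-γ) = l ^ γ * r ^ (-γ) := by
      rw [Real.div_rpow hr.le hl0.le, Real.rpow_neg hl0.le, div_inv_eq_mul, mul_comm]
    have h5 : l ^ γ * f z ≤ l ^ γ * (C * r ^ (-γ)) := mul_le_mul_of_nonneg_left hz hlg.le
    rw [h4]
    refine le_of_mul_le_mul_left (a := C) ?_ hC
    linarith

variable [MeasurableSpace E] [BorelSpace E] [FiniteDimensional ℝ E]

theorem setIntegral_sublevel_of_homogeneous (ν : Measure E) [ν.IsAddHaarMeasure] {q : E → ℝ}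
    {α : ℝ} (hq : ∀ s : ℝ, 0 < s → ∀ z : E, z ≠ 0 →
      q (s • z) = s ^ (-((Module.finrank ℝ E : ℝ) + α)) * q z)
    (hS : MeasurableSet {z : E | z ≠ 0 ∧ q z ≤ 1}) {r : ℝ} (hr : 0 < r) :
    ∫ z in {z : E | z ≠ 0 ∧ q z ≤ r ^ (-((Module.finrank ℝ E : ℝ) + α))}, q z ∂ν =
      r ^ (-α) * ∫ z in {z : E | z ≠ 0 ∧ q z ≤ 1}, q z ∂ν := by
  have h1 := Measure.setIntegral_comp_smul ν q {z : E | z ≠ 0 ∧ q z ≤ 1} hr.ne'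
  rw [smul_sublevel_of_homogeneous hq hr, setIntegral_congr_fun hS fun z hz => hq r hr z hz.1,
    integral_const_mul, abs_of_pos (by positivity), smul_eq_mul, neg_add, Real.rpow_add hr,
    Real.rpow_neg hr.le, Real.rpow_natCast, mul_assoc] at h1
  rw [neg_add, Real.rpow_add hr, Real.rpow_neg hr.le, Real.rpow_natCast]
  exact (mul_left_cancel₀ (by positivity) h1).symm

/-- The `f`-mass of the dilates of the level set of `q` decays like `r ^ (-α)`. -/
theorem tendsto_measure_sublevel_mul_rpow (ν : Measure E) [ν.IsAddHaarMeasure] {f q : E → ℝ}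
    {α C m : ℝ} (hC : 0 < C) (hα : 0 < α) (hm : 0 < m) (hf : Integrable f ν)
    (hqm : ∀ w : E, ‖w‖ = 1 → m ≤ q w)
    (hq : ∀ s : ℝ, 0 < s → ∀ z : E, z ≠ 0 →
      q (s • z) = s ^ (-((Module.finrank ℝ E : ℝ) + α)) * q z)
    (hqc : ContinuousOn q {0}ᶜ)
    (hratio : ∀ l : ℝ, 1 < l → ∃ R > 0, ∀ z : E, R ≤ ‖z‖ →
      C * q z ≤ l * f z ∧ f z ≤ l * (C * q z))
    (hS : 0 < ∫ z in {z : E | z ≠ 0 ∧ q z ≤ 1}, q z ∂ν) :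
    Tendsto (fun r : ℝ =>
      (∫ z in {z : E | z ≠ 0 ∧ q z ≤ r ^ (-((Module.finrank ℝ E : ℝ) + α))}, f z ∂ν) * r ^ α)
      atTop (𝓝 (C * ∫ z in {z : E | z ≠ 0 ∧ q z ≤ 1}, q z ∂ν)) := by
  have hscale := fun r hr =>
    setIntegral_sublevel_of_homogeneous ν hq (measurableSet_sublevel hqc 1) (r := r) hr
  set N := ∫ z in {z : E | z ≠ 0 ∧ q z ≤ 1}, q z ∂ν
  set γ := (Module.finrank ℝ E : ℝ) + α
  have hγ : 0 < γ := by positivity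
  have hCN : 0 < C * N := mul_pos hC hS
  have hbound : ∀ l : ℝ, 1 < l → ∀ᶠ r : ℝ in atTop,
      C * N ≤ l * ((∫ z in {z : E | z ≠ 0 ∧ q z ≤ r ^ (-γ)}, f z ∂ν) * r ^ α) ∧
      (∫ z in {z : E | z ≠ 0 ∧ q z ≤ r ^ (-γ)}, f z ∂ν) * r ^ α ≤ l * (C * N) := by
    intro l hl
    obtain ⟨R, hR, hfq⟩ := hratio l hl
    filter_upwards [eventually_gt_atTop 0,
      eventually_sublevel_subset_norm_ge hγ hm hqm hq hR] with r hr hrR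
    have hT := measurableSet_sublevel hqc (r ^ (-γ))
    have hra : 0 < r ^ α := Real.rpow_pos_of_pos hr α
    have hq_int : IntegrableOn q {z : E | z ≠ 0 ∧ q z ≤ r ^ (-γ)} ν := by
      refine Integrable.of_integral_ne_zero ?_
      rw [hscale r hr]
      positivity
    have h1 := setIntegral_mono_on (hq_int.const_mul C) (hf.integrableOn.const_mul l) hT
      fun z hz => (hfq z (hrR z hz.1 hz.2)).1
    have h2 := setIntegral_mono_on hf.integrableOn ((hq_int.const_mul C).const_mul l) hT
      fun z hz => (hfq z (hrR z hz.1 hz.2)).2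
    simp only [integral_const_mul, hscale r hr] at h1 h2
    have hinv : r ^ (-α) * r ^ α = 1 := by
      rw [Real.rpow_neg hr.le, inv_mul_cancel₀ hra.ne']
    have h3 := mul_le_mul_of_nonneg_right h1 hra.le
    have h4 := mul_le_mul_of_nonneg_right h2 hra.le
    constructor
    · calc C * N = C * (r ^ (-α) * N) * r ^ α := by linear_combination (-C * N) * hinv
        _ ≤ _ := h3.trans_eq (by ring)
    · calc _ ≤ _ := h4
        _ = _ := by linear_combination (l * C * N) * hinv
  refine tendsto_order.2 ⟨fun a ha => ?_, fun a ha => ?_⟩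
  · have hc : ContinuousAt (fun l : ℝ => l * a) 1 := by fun_prop
    obtain ⟨l, hla, hl⟩ : ∃ l : ℝ, l * a < C * N ∧ 1 < l :=
      ((hc.eventually_lt_const (by simpa using ha)).filter_mono
        nhdsWithin_le_nhds |>.and self_mem_nhdsWithin : ∀ᶠ l in 𝓝[>] (1 : ℝ), _).exists
    filter_upwards [hbound l hl] with r hr
    exact lt_of_mul_lt_mul_left (hla.trans_le hr.1) (by linarith)
  · have hc : ContinuousAt (fun l : ℝ => l * (C * N)) 1 := by fun_prop
    obtain ⟨l, hla, hl⟩ : ∃ l : ℝ, l * (C * N) < a ∧ 1 < l :=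
      ((hc.eventually_lt_const (by simpa using ha)).filter_mono
        nhdsWithin_le_nhds |>.and self_mem_nhdsWithin : ∀ᶠ l in 𝓝[>] (1 : ℝ), _).exists
    filter_upwards [hbound l hl] with r hr
    exact hr.2.trans_lt hla

end

/-- Let `T` be a family of sets with `P (T (l * r n)) ∼ l ^ (-α) * p n` that is interlaced with the
sublevel sets of `f`. If the sublevel set `{f ≤ β n}` has mass `p n`, it differs from `T (r n)` only
by a set of mass `o(p n)`. -/
theorem tendsto_measureReal_symmDiff_div {Ω : Type*} [MeasurableSpace Ω] (P : Measure Ω)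
    [IsFiniteMeasure P] {T : ℝ → Set Ω} {L : ℝ → ℝ} {f : Ω → ℝ} {α : ℝ} (hα : 0 < α)
    {r p β : ℕ → ℝ} (hT : ∀ r, MeasurableSet (T r)) (hTanti : AntitoneOn T (Set.Ioi 0))
    (hsand : ∀ l : ℝ, 1 < l → ∀ᶠ r : ℝ in atTop, T (l * r) ⊆ {z | f z ≤ L r} ∧
      {z | f z ≤ L r} ⊆ T (r / l))
    (hp : ∀ n, 0 < p n) (hr : Tendsto r atTop atTop)
    (hTr : ∀ l : ℝ, 0 < l → Tendsto (fun n => P.real (T (l * r n)) / p n) atTop (𝓝 (l ^ (-α))))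
    (hβ : ∀ n, P.real {z | f z ≤ β n} = p n) :
    Tendsto (fun n => P.real ({z | f z ≤ β n} ∆ T (r n)) / p n) atTop (𝓝 0) := by
  have hmono : ∀ {a b : ℝ}, a ≤ b → {z | f z ≤ a} ⊆ {z | f z ≤ b} := fun hab z hz =>
    le_trans (α := ℝ) hz hab
  have hcon : ∀ l : ℝ, 1 < l → ∀ᶠ n in atTop,
      T (l ^ 3 * r n) ⊆ {z | f z ≤ β n} ∧ {z | f z ≤ β n} ⊆ T (l⁻¹ ^ 3 * r n) := by
    intro l hl
    have hl0 : 0 < l := by linarith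
    have e1 := (hTr l hl0).eventually_lt_const
      (Real.rpow_lt_one_of_one_lt_of_neg hl (by linarith : -α < 0))
    have e2 := (hTr l⁻¹ (by positivity)).eventually_const_lt
      (Real.one_lt_rpow_of_pos_of_lt_one_of_neg (by positivity) (inv_lt_one_of_one_lt₀ hl)
        (by linarith : -α < 0))
    filter_upwards [e1, e2, (hr.const_mul_atTop (pow_pos hl0 2)).eventually (hsand l hl),
      (hr.const_mul_atTop (pow_pos (inv_pos.2 hl0) 2)).eventually (hsand l hl)]
      with n h1 h2 h3 h4
    rw [div_lt_one (hp n)] at h1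
    rw [one_lt_div (hp n)] at h2
    rw [show l * (l ^ 2 * r n) = l ^ 3 * r n by ring,
      show l ^ 2 * r n / l = l * r n by field_simp] at h3
    rw [show l * (l⁻¹ ^ 2 * r n) = l⁻¹ * r n by field_simp,
      show l⁻¹ ^ 2 * r n / l = l⁻¹ ^ 3 * r n by field_simp] at h4
    constructor
    · rcases le_total (L (l ^ 2 * r n)) (β n) with h | h
      · exact h3.1.trans (hmono h)
      · have := measureReal_mono (μ := P) ((hmono h).trans h3.2)
        rw [hβ] at this
        linarith
    · rcases le_total (β n) (L (l⁻¹ ^ 2 * r n)) with h | h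
      · exact (hmono h).trans h4.2
      · have := measureReal_mono (μ := P) (h4.1.trans (hmono h))
        rw [hβ] at this
        linarith
  refine tendsto_order.2 ⟨fun a ha => .of_forall fun n =>
    ha.trans_le (div_nonneg measureReal_nonneg (hp n).le), fun a ha => ?_⟩
  obtain ⟨l, hla, hl⟩ : ∃ l : ℝ, (l⁻¹ ^ 3) ^ (-α) - (l ^ 3) ^ (-α) < a ∧ 1 < l := by
    have hc : ContinuousAt (fun l : ℝ => (l⁻¹ ^ 3) ^ (-α) - (l ^ 3) ^ (-α)) 1 := by
      refine .sub (.rpow_const (.pow (continuousAt_inv₀ one_ne_zero) 3) (by simp))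
        (.rpow_const (by fun_prop) (by simp))
    exact ((hc.eventually_lt_const (by simpa using ha)).filter_mono
        nhdsWithin_le_nhds |>.and self_mem_nhdsWithin : ∀ᶠ l in 𝓝[>] (1 : ℝ), _).exists
  have hl0 : 0 < l := by linarith
  have hlim := (hTr (l⁻¹ ^ 3) (by positivity)).sub (hTr (l ^ 3) (by positivity))
  filter_upwards [hcon l hl, hlim.eventually_lt_const hla, hr.eventually_gt_atTop 0]
    with n ⟨h1, h2⟩ h3 hrn
  refine lt_of_le_of_lt ?_ h3
  have hpos : ∀ e : ℝ, 0 < e → e * r n ∈ Set.Ioi (0 : ℝ) := fun e he => mul_pos he hrn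
  have i1 : T (l ^ 3 * r n) ⊆ T (r n) := by
    refine hTanti hrn (hpos _ (by positivity)) ?_
    exact le_mul_of_one_le_left hrn.le (one_le_pow₀ hl.le)
  have i2 : T (r n) ⊆ T (l⁻¹ ^ 3 * r n) := by
    refine hTanti (hpos _ (by positivity)) hrn ?_
    exact mul_le_of_le_one_left hrn.le (pow_le_one₀ (by positivity) (inv_le_one_of_one_le₀ hl.le))
  rw [← sub_div, ← measureReal_sdiff (i1.trans i2) (hT _)]
  refine div_le_div_of_nonneg_right (measureReal_mono ?_) (hp n).le
  rintro z (⟨ha, hb⟩ | ⟨ha, hb⟩)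
  · exact ⟨h2 ha, fun h => hb (i1 h)⟩
  · exact ⟨i2 ha, fun h => hb (h1 h)⟩

/-- The dilation factors `r n = u n * (N / p n) ^ (1 / α)` with `u n → c` tend to infinity and
`r n ^ (-α)` is asymptotically proportional to `p n`. -/
theorem tendsto_dilation_factor {α c N : ℝ} (hα : 0 < α) (hc : 0 < c) (hN : 0 < N)
    {u p r : ℕ → ℝ} (hu : Tendsto u atTop (𝓝 c)) (hp : ∀ n, 0 < p n)
    (hp0 : Tendsto p atTop (𝓝 0)) (hr : ∀ᶠ n in atTop, r n = u n * (N / p n) ^ (1 / α)) :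
    Tendsto r atTop atTop ∧
      Tendsto (fun n => r n ^ (-α) / p n) atTop (𝓝 (c ^ α * N)⁻¹) := by
  constructor
  · have h1 : Tendsto (fun n => N / p n) atTop atTop :=
      Tendsto.const_mul_atTop hN (f := fun n => (p n)⁻¹)
        (tendsto_inv_nhdsGT_zero.comp (tendsto_nhdsWithin_iff.2 ⟨hp0, .of_forall hp⟩))
    exact (hu.pos_mul_atTop hc ((tendsto_rpow_atTop (by positivity)).comp h1)).congr'
      (hr.mono fun n hn => hn.symm)
  · have h1 := (hu.rpow_const (p := -α) (Or.inl hc.ne')).div_const N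
    rw [show (c ^ α * N)⁻¹ = c ^ (-α) / N by
      rw [Real.rpow_neg hc.le, mul_inv, div_eq_mul_inv]]
    refine h1.congr' ?_
    filter_upwards [hr, hu.eventually_const_lt hc] with n hn hun
    have := hp n
    rw [hn, Real.mul_rpow hun.le (by positivity), Real.rpow_neg (by positivity) α,
      ← Real.rpow_mul (by positivity), mul_comm (1 / α), neg_mul, mul_one_div_cancel hα.ne',
      Real.rpow_neg_one]
    · field_simp

/-- Proposition 1: If `Q_n = {z : f(z) ≤ β_n}` with `P(Q_n) = p_n`
and `Q̃_n = U(n/k)(kν(S)/(np))^{1/α} S`, then `P(Q_n △ Q̃_n)/p_n → 0`. -/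
theorem extreme_risk_Qn_Qtilde_symmDiff
    (d : ℕ) (hd : 2 ≤ d)
    (P : Measure (EuclideanSpace ℝ (Fin d))) [IsProbabilityMeasure P]
    (f : EuclideanSpace ℝ (Fin d) → ℝ)
    (hf_cont : Continuous f) (hf_pos : ∀ z, 0 < f z)
    (hP : P = volume.withDensity (fun z => ENNReal.ofReal (f z)))
    (α : ℝ) (hα : 0 < α)
    -- V = 1 − H, regularly varying with index −α
    (V : ℝ → ℝ)
    (hV_def : ∀ t : ℝ, V t = (P {z | t < ‖z‖}).toReal)
    (hV_rv : ∀ x > (0 : ℝ),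
      Tendsto (fun t => V (t * x) / V t) atTop (𝓝 (x ^ (-α))))
    (q : EuclideanSpace ℝ (Fin d) → ℝ)
    (hq_nonneg : ∀ z : EuclideanSpace ℝ (Fin d), z ≠ 0 → 0 ≤ q z)
    (hq_lim : ∀ z : EuclideanSpace ℝ (Fin d), z ≠ 0 →
      Tendsto (fun t : ℝ => f (t • z) / (t ^ (-(d : ℝ)) * V t)) atTop (𝓝 (q z)))
    (hq_unif : ∀ δ > (0 : ℝ), ∃ t₀ > (0 : ℝ), ∀ t ≥ t₀,
      ∀ z : EuclideanSpace ℝ (Fin d), ‖z‖ = 1 →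
        |f (t • z) / (t ^ (-(d : ℝ)) * V t) - q z| ≤ δ)
    (hq_pos : ∀ w : EuclideanSpace ℝ (Fin d), ‖w‖ = 1 → 0 < q w)
    -- ν(S) ∈ (0,∞), S = {z ≠ 0 : q(z) ≤ 1}
    (hS_int : IntegrableOn q {z : EuclideanSpace ℝ (Fin d) | z ≠ 0 ∧ q z ≤ 1} volume)
    (νS : ℝ) (hνS : νS = ∫ z in {z : EuclideanSpace ℝ (Fin d) | z ≠ 0 ∧ q z ≤ 1}, q z)
    (hνS_pos : 0 < νS)
    -- the quantile function U(t) = H⁻¹(1 − 1/t), satisfying condition (c)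
    (U : ℝ → ℝ)
    (hU : ∀ t > (1 : ℝ), P {z | ‖z‖ ≤ U t} = ENNReal.ofReal (1 - 1 / t))
    (c : ℝ) (hc : 0 < c)
    (hUc : Tendsto (fun t : ℝ => U t / t ^ (1 / α)) atTop (𝓝 c))
    -- condition (b) and p → 0
    (k : ℕ → ℕ) (hk_pos : ∀ n, 0 < k n)
    (hk_top : Tendsto (fun n => (k n : ℝ)) atTop atTop)
    (hkn : Tendsto (fun n => (k n : ℝ) / n) atTop (𝓝 0))
    (p : ℕ → ℝ) (hp_mem : ∀ n, p n ∈ Set.Ioo (0 : ℝ) 1)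
    (hp0 : Tendsto p atTop (𝓝 0))
    -- β_n chosen so that P(Q_n) = p_n
    (β : ℕ → ℝ) (hβ_pos : ∀ n, 0 < β n)
    (hβ : ∀ n, P {z : EuclideanSpace ℝ (Fin d) | f z ≤ β n} = ENNReal.ofReal (p n)) :
    Tendsto (fun n : ℕ =>
        (P ({z : EuclideanSpace ℝ (Fin d) | f z ≤ β n} ∆
            ((U ((n : ℝ) / k n) * ((k n * νS) / (n * p n)) ^ (1 / α)) •
              {z : EuclideanSpace ℝ (Fin d) | z ≠ 0 ∧ q z ≤ 1}))).toReal / p n)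
      atTop (𝓝 0) := by
  have hC : 0 < c ^ α := Real.rpow_pos_of_pos hc α
  have hfin : Module.finrank ℝ (EuclideanSpace ℝ (Fin d)) = d := by simp
  set C := c ^ α
  have hVanti : Antitone V := by
    intro s t hst
    rw [hV_def, hV_def]
    exact measureReal_mono (μ := P) fun z hz => lt_of_le_of_lt hst hz
  have hVU : ∀ t > 1, V (U t) = 1 / t := by
    intro t ht
    have h1 : {z : EuclideanSpace ℝ (Fin d) | U t < ‖z‖} = {z | ‖z‖ ≤ U t}ᶜ := by
      ext z; simp
    have h2 : 1 / t ≤ 1 := by rw [div_le_one (by linarith)]; exact ht.le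
    rw [hV_def, h1, ← Measure.real, probReal_compl_eq_one_sub
      (measurableSet_le measurable_norm measurable_const), Measure.real, hU t ht,
      ENNReal.toReal_ofReal (by linarith)]
    ring
  have hV : Tendsto (fun t => V t * t ^ α) atTop (𝓝 C) :=
    tendsto_survival_mul_rpow hα hc hVanti hVU hUc
  have hlim : ∀ z : EuclideanSpace ℝ (Fin d), z ≠ 0 →
      Tendsto (fun t : ℝ => t ^ ((d : ℝ) + α) * f (t • z)) atTop (𝓝 (C * q z)) := by
    intro z hz
    refine (hV.mul (hq_lim z hz)).congr' ?_
    filter_upwards [eventually_gt_atTop 0, hV.eventually_const_lt hC] with t ht hvt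
    have h1 := Real.rpow_pos_of_pos ht α
    have h2 := Real.rpow_pos_of_pos ht (d : ℝ)
    have h3 : V t ≠ 0 := left_ne_zero_of_mul hvt.ne'
    rw [Real.rpow_add ht, Real.rpow_neg ht.le]
    field_simp
  have hq : ∀ s : ℝ, 0 < s → ∀ z : EuclideanSpace ℝ (Fin d), z ≠ 0 →
      q (s • z) = s ^ (-((d : ℝ) + α)) * q z := fun s hs z hz =>
    homogeneous_of_tendsto hC hlim hs hz
  have hqS : ContinuousOn q (Metric.sphere 0 1) := by
    refine TendstoUniformlyOn.continuousOn
      (F := fun (t : ℝ) z => f (t • z) / (t ^ (-(d : ℝ)) * V t)) (p := atTop)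
      (Metric.tendstoUniformlyOn_iff.2 fun ε hε => ?_)
      (Frequently.of_forall fun t => by fun_prop)
    obtain ⟨t₀, -, ht⟩ := hq_unif (ε / 2) (by positivity)
    filter_upwards [eventually_ge_atTop t₀] with t htt z hz
    rw [dist_comm, Real.dist_eq]
    linarith [ht t htt z (by simpa using hz)]
  have hqc := continuousOn_compl_zero_of_homogeneous hq hqS
  obtain ⟨m, hm, hqm'⟩ := (isCompact_sphere (0 : EuclideanSpace ℝ (Fin d)) 1).exists_forall_le'
    hqS (a := 0) fun w hw => hq_pos w (by simpa using hw)
  have hqm : ∀ w : EuclideanSpace ℝ (Fin d), ‖w‖ = 1 → m ≤ q w := fun w hw =>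
    hqm' w (by simpa using hw)
  have hratio : ∀ l : ℝ, 1 < l → ∃ R > 0, ∀ z : EuclideanSpace ℝ (Fin d), R ≤ ‖z‖ →
      C * q z ≤ l * f z ∧ f z ≤ l * (C * q z) := fun l hl =>
    exists_norm_ge_ratio hC hm hqm hq hV hq_unif hl
  have hPint : ∀ s, P.real s = ∫ z in s, f z := by
    intro s
    rw [Measure.real, hP, withDensity_apply', integral_eq_lintegral_of_nonneg_ae
      (.of_forall fun z => (hf_pos z).le) hf_cont.aestronglyMeasurable]
  have hfint : Integrable f := by
    refine Integrable.of_integral_ne_zero ?_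
    rw [← setIntegral_univ, ← hPint]
    simp
  have hmass := tendsto_measure_sublevel_mul_rpow volume hC hα hm hfint hqm
    (by rwa [hfin]) hqc hratio (hνS ▸ hνS_pos)
  rw [hfin, ← hνS] at hmass
  simp only [← hPint] at hmass
  have hnk : Tendsto (fun n : ℕ => (n : ℝ) / k n) atTop atTop := by
    have h1 : Tendsto (fun n : ℕ => ((k n : ℝ) / n)⁻¹) atTop atTop := by
      refine tendsto_inv_nhdsGT_zero.comp (tendsto_nhdsWithin_iff.2 ⟨hkn, ?_⟩)
      filter_upwards [eventually_gt_atTop 0] with n hn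
      have := hk_pos n
      exact Set.mem_Ioi.2 (by positivity)
    simpa using h1
  have hp := fun n => (hp_mem n).1
  obtain ⟨r, hr_eq⟩ : ∃ r : ℕ → ℝ, ∀ n,
      r n = U ((n : ℝ) / k n) * ((k n * νS) / (n * p n)) ^ (1 / α) := ⟨_, fun _ => rfl⟩
  obtain ⟨hr, hrp⟩ := tendsto_dilation_factor hα hc hνS_pos (hUc.comp hnk) hp hp0
    (r := r) (by
      filter_upwards [eventually_gt_atTop 0] with n hn
      have hk := hk_pos n
      have := hp n
      have h1 : (k n * νS) / (n * p n) = (νS / p n) / ((n : ℝ) / k n) := by field_simp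
      rw [hr_eq, h1, Real.div_rpow (by positivity) (by positivity), Function.comp_apply]
      ring)
  set T : ℝ → Set (EuclideanSpace ℝ (Fin d)) :=
    fun r => {z | z ≠ 0 ∧ q z ≤ r ^ (-((d : ℝ) + α))}
  have hTr : ∀ l : ℝ, 0 < l →
      Tendsto (fun n => P.real (T (l * r n)) / p n) atTop (𝓝 (l ^ (-α))) := by
    intro l hl
    have h1 := ((hmass.comp (hr.const_mul_atTop hl)).mul hrp).const_mul (l ^ (-α))
    rw [mul_inv_cancel₀ (by positivity), mul_one] at h1
    refine h1.congr' ?_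
    filter_upwards [hr.eventually_gt_atTop 0] with n hn
    have h2 := Real.rpow_pos_of_pos hn α
    have h3 := Real.rpow_pos_of_pos hl α
    have h4 := hp n
    change l ^ (-α) * (P.real (T (l * r n)) * (l * r n) ^ α * (r n ^ (-α) / p n)) = _
    generalize P.real (T (l * r n)) = x
    rw [Real.mul_rpow hl.le hn.le, Real.rpow_neg hl.le, Real.rpow_neg hn.le]
    field_simp
  have hfinal := tendsto_measureReal_symmDiff_div P (T := T)
    (L := fun r => C * r ^ (-((d : ℝ) + α))) (f := f) (β := β) hα
    (fun r => measurableSet_sublevel hqc _)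
    (fun s hs t _ hst z hz => ⟨hz.1, hz.2.trans
      (Real.rpow_le_rpow_of_nonpos hs hst (by linarith [(Nat.cast_nonneg d : (0 : ℝ) ≤ d)]))⟩)
    (fun l hl => eventually_sublevel_sandwich hC (by positivity) hm hf_cont hf_pos hqm hq
      hratio hl)
    hp hr hTr
    (fun n => by rw [Measure.real, hβ, ENNReal.toReal_ofReal (hp n).le])
  refine hfinal.congr' ?_
  filter_upwards [hr.eventually_gt_atTop 0] with n hn
  rw [← hr_eq, smul_sublevel_of_homogeneous hq hn]
  rfl
end
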